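/- arXiv:0812.4328 — 9 statements merged into one kernel-verified Lean document; each statement's English description precedes it below -/
import Mathlib

section
/- Let a < b be reals, let f, g, G : ℝ → ℝ be continuous on (a,b), and let U, V : ℝ → ℝ be twice differentiable on (a,b) satisfying U''(t) + f(t)·U'(t) + g(t)·U(t) = 0 and V''(t) + f(t)·V'(t) + G(t)·V(t) = 0 for all t ∈ (a,b). Let [α,β) ⊆ (a,b) be an interval such that U(t) ≠ 0 and V(t) ≠ 0 for all t ∈ [α,β), and such that G(t) ≥ g(t) for all t ∈ (α,β). If V'(α)/V(α) ≤ U'(α)/U(α), then V'(t)/V(t) ≤ U'(t)/U(t) for all t ∈ (α,β). -/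
open Real Set

/-- A function continuous on an open interval has a primitive there. -/
theorem exists_hasDerivAt_of_continuousOn_Ioo {a b c : ℝ} {f : ℝ → ℝ}
    (hf : ContinuousOn f (Ioo a b)) (hc : c ∈ Ioo a b) :
    ∃ F : ℝ → ℝ, ∀ t ∈ Ioo a b, HasDerivAt F (f t) t := by
  refine ⟨fun t => ∫ x in c..t, f x, fun t ht => ?_⟩
  apply intervalIntegral.integral_hasDerivAt_right
  · exact (hf.mono (ordConnected_Ioo.uIcc_subset hc ht)).intervalIntegrable
  · exact hf.stronglyMeasurableAtFilter isOpen_Ioo t ht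
  · exact hf.continuousAt (isOpen_Ioo.mem_nhds ht)

/-- Sturm comparison theorem: for solutions `U` of `U'' + f U' + g U = 0` and
`V` of `V'' + f V' + G V = 0` with `G ≥ g`, if `V'/V ≤ U'/U` at the left
endpoint `α`, then `V'/V ≤ U'/U` throughout `(α, β)`. -/
theorem sturm_comparison
    (a b α β : ℝ) (f g G U V : ℝ → ℝ)
    (hab : a < b) (hαβ : α < β)
    (hf : ContinuousOn f (Ioo a b))
    (hg : ContinuousOn g (Ioo a b))
    (hG : ContinuousOn G (Ioo a b))
    (hUdiff : ∀ t ∈ Ioo a b, DifferentiableAt ℝ U t)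
    (hUdiff2 : ∀ t ∈ Ioo a b, DifferentiableAt ℝ (deriv U) t)
    (hVdiff : ∀ t ∈ Ioo a b, DifferentiableAt ℝ V t)
    (hVdiff2 : ∀ t ∈ Ioo a b, DifferentiableAt ℝ (deriv V) t)
    (hUode : ∀ t ∈ Ioo a b,
      deriv (deriv U) t + f t * deriv U t + g t * U t = 0)
    (hVode : ∀ t ∈ Ioo a b,
      deriv (deriv V) t + f t * deriv V t + G t * V t = 0)
    (hsub : Ico α β ⊆ Ioo a b)
    (hU0 : ∀ t ∈ Ico α β, U t ≠ 0)
    (hV0 : ∀ t ∈ Ico α β, V t ≠ 0)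
    (hGg : ∀ t ∈ Ioo α β, g t ≤ G t)
    (hinit : deriv V α / V α ≤ deriv U α / U α) :
    ∀ t ∈ Ioo α β, deriv V t / V t ≤ deriv U t / U t := by
  obtain ⟨F, hF⟩ := exists_hasDerivAt_of_continuousOn_Ioo hf (hsub (left_mem_Ico.2 hαβ))
  set D : ℝ → ℝ := fun t => deriv U t / U t - deriv V t / V t
  set E : ℝ → ℝ := fun t => exp (F t + log (U t) + log (V t))
  have hderiv : ∀ t ∈ Ico α β,
      HasDerivAt (fun t => E t * D t) (E t * (G t - g t)) t := by
    intro t ht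
    have hab_t := hsub ht
    have hU := (hUdiff t hab_t).hasDerivAt
    have hV := (hVdiff t hab_t).hasDerivAt
    have hEt : HasDerivAt E (E t * (f t + deriv U t / U t + deriv V t / V t)) t :=
      (((hF t hab_t).add (hU.log (hU0 t ht))).add (hV.log (hV0 t ht))).exp
    have hDt := ((hUdiff2 t hab_t).hasDerivAt.div hU (hU0 t ht)).sub
      ((hVdiff2 t hab_t).hasDerivAt.div hV (hV0 t ht))
    refine (hEt.mul hDt).congr_deriv ?_
    have hU2 : deriv (deriv U) t = -(f t * deriv U t) - g t * U t := by
      linarith [hUode t hab_t]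
    have hV2 : deriv (deriv V) t = -(f t * deriv V t) - G t * V t := by
      linarith [hVode t hab_t]
    have hUt := hU0 t ht
    have hVt := hV0 t ht
    simp only [Pi.sub_apply, Pi.div_apply]
    rw [hU2, hV2]
    field_simp
    ring
  have hmono : MonotoneOn (fun t => E t * D t) (Ico α β) := by
    refine monotoneOn_of_hasDerivWithinAt_nonneg (convex_Ico α β)
      (fun t ht => (hderiv t ht).continuousAt.continuousWithinAt)
      (fun t ht => (hderiv t (interior_subset ht)).hasDerivWithinAt) fun t ht => ?_
    rw [interior_Ico] at ht
    exact mul_nonneg (exp_pos _).le (sub_nonneg.2 (hGg t ht))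
  intro t ht
  have hle : E α * D α ≤ E t * D t :=
    hmono (left_mem_Ico.2 hαβ) (Ioo_subset_Ico_self ht) ht.1.le
  have h0 : 0 ≤ E t * D t := (mul_nonneg (exp_pos _).le (sub_nonneg.2 hinit)).trans hle
  exact sub_nonneg.1 (nonneg_of_mul_nonneg_right h0 (exp_pos _))
end

section
/- Let a < b be reals, let f, g, G : ℝ → ℝ be continuous on (a,b), and let U, V : ℝ → ℝ be twice differentiable on (a,b) satisfying U''(t) + f(t)·U'(t) + g(t)·U(t) = 0 and V''(t) + f(t)·V'(t) + G(t)·V(t) = 0 for all t ∈ (a,b). Let [α,β) ⊆ (a,b) be an interval such that U(t) ≠ 0 and V(t) ≠ 0 for all t ∈ [α,β), G(t) ≥ g(t) for all t ∈ (α,β), and V'(α)/V(α) ≤ U'(α)/U(α). If V'(x)/V(x) = U'(x)/U(x) for some x ∈ (α,β), then V'(t)/V(t) = U'(t)/U(t) for all t ∈ [α,x] and G(t) = g(t) for all t ∈ (α,x). -/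
open Real Set

/-- A continuous function on an open interval has an antiderivative there. -/
theorem exists_antiderivative_on_Ioo {a b α : ℝ} {f : ℝ → ℝ}
    (hf : ContinuousOn f (Ioo a b)) (hα : α ∈ Ioo a b) :
    ∃ F : ℝ → ℝ, ∀ t ∈ Ioo a b, HasDerivAt F (f t) t := by
  refine ⟨fun t => ∫ s in α..t, f s, fun t ht => ?_⟩
  have hsub : uIcc α t ⊆ Ioo a b := ordConnected_Ioo.uIcc_subset hα ht
  exact intervalIntegral.integral_hasDerivAt_right (hf.mono hsub).intervalIntegrable
    (hf.stronglyMeasurableAtFilter isOpen_Ioo t ht) (hf.continuousAt (isOpen_Ioo.mem_nhds ht))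

/-- A nonvanishing continuous function on an interval keeps the sign it has at the left end. -/
theorem mul_pos_of_continuousOn_of_ne_zero {h : ℝ → ℝ} {α x t : ℝ}
    (hh : ContinuousOn h (Icc α x)) (h0 : ∀ s ∈ Icc α x, h s ≠ 0) (ht : t ∈ Icc α x) :
    0 < h α * h t := by
  have hα : α ∈ Icc α x := ⟨le_rfl, ht.1.trans ht.2⟩
  by_contra! hle
  have hmem : (0 : ℝ) ∈ uIcc (h α) (h t) := by
    rw [mem_uIcc]
    rcases mul_nonpos_iff.mp hle with h1 | h1
    · exact Or.inr ⟨h1.2, h1.1⟩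
    · exact Or.inl h1
  have hsub : uIcc α t ⊆ Icc α x := ordConnected_Icc.uIcc_subset hα ht
  obtain ⟨s, hs, hs0⟩ := intermediate_value_uIcc (hh.mono hsub) hmem
  exact h0 s (hsub hs) hs0

/-- A function with nonnegative derivative that is nonnegative at the left end of an interval and
vanishes at the right end is zero throughout. -/
theorem eq_zero_of_hasDerivAt_nonneg {Q Q' : ℝ → ℝ} {α x : ℝ} (hαx : α ≤ x)
    (hQ : ∀ t ∈ Icc α x, HasDerivAt Q (Q' t) t) (hQ' : ∀ t ∈ Ioo α x, 0 ≤ Q' t)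
    (hα : 0 ≤ Q α) (hx : Q x = 0) : ∀ t ∈ Icc α x, Q t = 0 := by
  have hmono : MonotoneOn Q (Icc α x) := by
    refine monotoneOn_of_hasDerivWithinAt_nonneg (f' := Q') (convex_Icc α x)
      (fun t ht => (hQ t ht).continuousAt.continuousWithinAt) (fun t ht => ?_) (fun t ht => ?_)
    · exact (hQ t (interior_subset ht)).hasDerivWithinAt
    · rw [interior_Icc] at ht
      exact hQ' t ht
  intro t ht
  have h1 := hmono ⟨le_rfl, hαx⟩ ht ht.1
  have h2 := hmono ht ⟨hαx, le_rfl⟩ ht.2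
  linarith

/-- Equality (rigidity) case of the Sturm comparison theorem: if moreover
`V'/V = U'/U` at some `x ∈ (α, β)`, then `V'/V = U'/U` on all of `[α, x]`
and `G = g` on `(α, x)`. -/
theorem sturm_comparison_rigidity
    (a b α β x : ℝ) (f g G U V : ℝ → ℝ)
    (hab : a < b) (hαβ : α < β)
    (hf : ContinuousOn f (Ioo a b))
    (hg : ContinuousOn g (Ioo a b))
    (hG : ContinuousOn G (Ioo a b))
    (hUdiff : ∀ t ∈ Ioo a b, DifferentiableAt ℝ U t)
    (hUdiff2 : ∀ t ∈ Ioo a b, DifferentiableAt ℝ (deriv U) t)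
    (hVdiff : ∀ t ∈ Ioo a b, DifferentiableAt ℝ V t)
    (hVdiff2 : ∀ t ∈ Ioo a b, DifferentiableAt ℝ (deriv V) t)
    (hUode : ∀ t ∈ Ioo a b,
      deriv (deriv U) t + f t * deriv U t + g t * U t = 0)
    (hVode : ∀ t ∈ Ioo a b,
      deriv (deriv V) t + f t * deriv V t + G t * V t = 0)
    (hsub : Ico α β ⊆ Ioo a b)
    (hU0 : ∀ t ∈ Ico α β, U t ≠ 0)
    (hV0 : ∀ t ∈ Ico α β, V t ≠ 0)
    (hGg : ∀ t ∈ Ioo α β, g t ≤ G t)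
    (hinit : deriv V α / V α ≤ deriv U α / U α)
    (hx : x ∈ Ioo α β)
    (heq : deriv V x / V x = deriv U x / U x) :
    (∀ t ∈ Icc α x, deriv V t / V t = deriv U t / U t) ∧
      (∀ t ∈ Ioo α x, G t = g t) := by
  have hsub' : Icc α x ⊆ Ico α β := fun t ht => ⟨ht.1, ht.2.trans_lt hx.2⟩
  have hα : α ∈ Icc α x := ⟨le_rfl, hx.1.le⟩
  have hx' : x ∈ Icc α x := ⟨hx.1.le, le_rfl⟩
  obtain ⟨F, hF⟩ := exists_antiderivative_on_Ioo hf (hsub (hsub' hα))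
  have hUV0 : ∀ t ∈ Icc α x, U t * V t ≠ 0 := fun t ht =>
    mul_ne_zero (hU0 t (hsub' ht)) (hV0 t (hsub' ht))
  have hpos : ∀ t ∈ Icc α x, 0 < U α * V α * (U t * V t) := fun t ht =>
    mul_pos_of_continuousOn_of_ne_zero (h := fun t => U t * V t)
      (fun s hs => ((hUdiff s (hsub (hsub' hs))).continuousAt.mul
        (hVdiff s (hsub (hsub' hs))).continuousAt).continuousWithinAt) hUV0 ht
  -- The Wronskian times an integrating factor, normalised by the constant sign of the product.
  let Q : ℝ → ℝ := fun t => U α * V α * (exp (F t) * (deriv U t * V t - U t * deriv V t))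
  let Q' : ℝ → ℝ := fun t => exp (F t) * (U α * V α * (U t * V t)) * (G t - g t)
  have hQ : ∀ t ∈ Icc α x, HasDerivAt Q (Q' t) t := fun t ht => by
    have hm := hsub (hsub' ht)
    have hU := (hUdiff t hm).hasDerivAt
    have hV := (hVdiff t hm).hasDerivAt
    have hU' := (hUdiff2 t hm).hasDerivAt
    have hV' := (hVdiff2 t hm).hasDerivAt
    refine (((hF t hm).exp.mul ((hU'.mul hV).sub (hU.mul hV'))).const_mul
      (U α * V α)).congr_deriv ?_
    simp only [Q', Pi.sub_apply, Pi.mul_apply]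
    linear_combination U α * V α * exp (F t) * (V t * hUode t hm - U t * hVode t hm)
  have hQ_eq : ∀ t ∈ Icc α x, Q t =
      exp (F t) * (U α * V α * (U t * V t)) * (deriv U t / U t - deriv V t / V t) := by
    intro t ht
    have hU := hU0 t (hsub' ht)
    have hV := hV0 t (hsub' ht)
    simp only [Q]
    field_simp
  have hfactor : ∀ t ∈ Icc α x, 0 < exp (F t) * (U α * V α * (U t * V t)) := fun t ht =>
    mul_pos (exp_pos _) (hpos t ht)
  have hQ0 : ∀ t ∈ Icc α x, Q t = 0 := by
    refine eq_zero_of_hasDerivAt_nonneg hx.1.le hQ (fun t ht => ?_) ?_ ?_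
    · exact mul_nonneg (hfactor t (Ioo_subset_Icc_self ht)).le
        (sub_nonneg.mpr (hGg t ⟨ht.1, ht.2.trans hx.2⟩))
    · rw [hQ_eq α hα]
      exact mul_nonneg (hfactor α hα).le (sub_nonneg.mpr hinit)
    · rw [hQ_eq x hx', heq, sub_self, mul_zero]
  refine ⟨fun t ht => ?_, fun t ht => ?_⟩
  · have h := hQ0 t ht
    rw [hQ_eq t ht] at h
    exact (sub_eq_zero.mp ((mul_eq_zero.mp h).resolve_left (hfactor t ht).ne')).symm
  · have ht' := Ioo_subset_Icc_self ht
    have hzero : Q =ᶠ[nhds t] fun _ => 0 := by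
      filter_upwards [isOpen_Ioo.mem_nhds ht] with s hs using hQ0 s (Ioo_subset_Icc_self hs)
    have h : Q' t = 0 := (hQ t ht').unique ((hasDerivAt_const t 0).congr_of_eventuallyEq hzero)
    exact sub_eq_zero.mp ((mul_eq_zero.mp h).resolve_left (hfactor t ht').ne')
end

section
/- Fix integers m ≥ 2 and n ≥ 0, and set A = n(n+m−1). If w is a normalized solution of the linearized equation with parameter A, then there exists a polynomial P with rational coefficients such that w(t) = P(cos t) for all t ∈ [0,π], and the coefficient of X^j in P vanishes unless j ≤ n and j ≡ n (mod 2). -/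
open Real Set

/-- `w` is a normalized solution of the linearized equation
`w'' + (m-1) (cos t / sin t) w' + A w = 0` on `(0, π)`,
with `w(0) = 1` and `w'(0) = 0`. -/
def IsNormalizedLinSolution (m : ℕ) (A : ℝ) (w : ℝ → ℝ) : Prop :=
  ContinuousOn w (Set.Icc 0 π) ∧
  (∀ t ∈ Set.Icc (0 : ℝ) π, DifferentiableAt ℝ w t) ∧
  (∀ t ∈ Set.Ioo (0 : ℝ) π, DifferentiableAt ℝ (deriv w) t) ∧
  w 0 = 1 ∧ deriv w 0 = 0 ∧
  ∀ t ∈ Set.Ioo (0 : ℝ) π,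
    deriv (deriv w) t + ((m : ℝ) - 1) * (Real.cos t / Real.sin t) * deriv w t
      + A * w t = 0

open Polynomial in
/-- The Gegenbauer polynomial of degree `n` attached to `m`, normalized to take the value `1`
at `1`. -/
noncomputable def normalizedGegenbauer (m : ℕ) : ℕ → ℚ[X]
  | 0 => 1
  | n + 1 => X * normalizedGegenbauer m n -
      C ((n : ℚ) + m - 1)⁻¹ * ((1 - X ^ 2) * derivative (normalizedGegenbauer m n))

namespace normalizedGegenbauer

open Polynomial

lemma eval_one (m n : ℕ) : (normalizedGegenbauer m n).eval 1 = 1 := by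
  induction n with
  | zero => simp [normalizedGegenbauer]
  | succ n ih => simp [normalizedGegenbauer, ih]

lemma coeff_eq_zero (m n j : ℕ) (hj : ¬ (j ≤ n ∧ j % 2 = n % 2)) :
    (normalizedGegenbauer m n).coeff j = 0 := by
  induction n generalizing j with
  | zero =>
    rw [normalizedGegenbauer, coeff_one, if_neg (by lia)]
  | succ n ih =>
    have hX : (X * normalizedGegenbauer m n).coeff j = 0 := by
      cases j with
      | zero => simp
      | succ i => rw [coeff_X_mul]; exact ih i (by lia)
    have hder : (derivative (normalizedGegenbauer m n)).coeff j = 0 := by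
      rw [coeff_derivative, ih (j + 1) (by lia), zero_mul]
    have hXder : (X ^ 2 * derivative (normalizedGegenbauer m n)).coeff j = 0 := by
      rw [coeff_X_pow_mul']
      split_ifs with h
      · rw [coeff_derivative, ih (j - 2 + 1) (by lia), zero_mul]
      · rfl
    rw [normalizedGegenbauer, coeff_sub, coeff_C_mul, sub_mul, one_mul, coeff_sub, hX, hder, hXder]
    simp

lemma differential_equation (m n : ℕ) (hm : 2 ≤ m) :
    (1 - X ^ 2) * derivative (derivative (normalizedGegenbauer m n)) -
      C (m : ℚ) * X * derivative (normalizedGegenbauer m n) +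
      C ((n : ℚ) * ((n : ℚ) + m - 1)) * normalizedGegenbauer m n = 0 := by
  induction n with
  | zero => simp [normalizedGegenbauer]
  | succ n ih =>
    have hm' : (2 : ℚ) ≤ m := by exact_mod_cast hm
    have hk : (n : ℚ) + m - 1 ≠ 0 := by
      have : (0 : ℚ) ≤ n := n.cast_nonneg
      linarith
    have hinv : C ((n : ℚ) + m - 1) * C ((n : ℚ) + m - 1)⁻¹ = (1 : ℚ[X]) := by
      rw [← C_mul, mul_inv_cancel₀ hk, C_1]
    have hinv0 : C ((n : ℚ) + m - 1) ≠ (0 : ℚ[X]) := C_ne_zero.mpr hk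
    set P := normalizedGegenbauer m n
    set Q := normalizedGegenbauer m (n + 1) with hQ
    have h0 : C ((n : ℚ) + m - 1) * Q =
        C ((n : ℚ) + m - 1) * X * P - (1 - X ^ 2) * derivative P := by
      rw [hQ, normalizedGegenbauer]
      linear_combination (-(1 - X ^ 2) * derivative P) * hinv
    have h1 : C ((n : ℚ) + m - 1) * derivative Q =
        ((n : ℚ[X]) + 1) * (C ((n : ℚ) + m - 1) * P + X * derivative P) := by
      have := congrArg derivative h0
      simp only [derivative_mul, derivative_C, derivative_sub, derivative_X, derivative_X_pow,
        derivative_one] at this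
      simp only [map_add, map_sub, map_mul, map_natCast, map_one] at this ih ⊢
      push_cast at this
      linear_combination this - ih
    have h2 : C ((n : ℚ) + m - 1) * derivative (derivative Q) =
        ((n : ℚ[X]) + 1) * (C ((n : ℚ) + m - 1) * derivative P + derivative P
          + X * derivative (derivative P)) := by
      have := congrArg derivative h1
      simp only [derivative_mul, derivative_C, derivative_add, derivative_X, derivative_natCast,
        derivative_one] at this
      linear_combination this
    refine (mul_eq_zero.mp ?_).resolve_left hinv0
    simp only [map_add, map_sub, map_mul, map_natCast, map_one, Nat.cast_add, Nat.cast_one]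
      at h0 h1 h2 ih ⊢
    linear_combination (1 - X ^ 2) * h2 - (m : ℚ[X]) * X * h1
      + ((n : ℚ[X]) + 1) * ((n : ℚ[X]) + m) * h0 + ((n : ℚ[X]) + 1) * X * ih

end normalizedGegenbauer

section Uniqueness

variable {u v : ℝ → ℝ} {c A : ℝ}

lemma energy_eq_zero_of_le_pi_div_two (hc : 0 ≤ c) (hA : 0 ≤ A)
    (hu : ∀ t ∈ Ico (0 : ℝ) π, HasDerivAt u (v t) t)
    (hv : ∀ t ∈ Ioo (0 : ℝ) π, HasDerivAt v (-(c * (cos t / sin t) * v t) - A * u t) t)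
    (hu0 : u 0 = 0) (hv0 : v 0 = 0) {t : ℝ} (ht : t ∈ Ioc 0 (π / 2)) :
    v t ^ 2 + A * u t ^ 2 = 0 := by
  have hE : ∀ s ∈ Ioo (0 : ℝ) π, HasDerivAt (fun s => v s ^ 2 + A * u s ^ 2)
      (-(2 * c * (cos s / sin s) * v s ^ 2)) s := by
    intro s hs
    refine (((hv s hs).pow 2).add (((hu s ⟨hs.1.le, hs.2⟩).pow 2).const_mul A)).congr_deriv ?_
    push_cast
    ring
  have hanti : AntitoneOn (fun s => v s ^ 2 + A * u s ^ 2) (Ioc 0 (π / 2)) := by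
    refine antitoneOn_of_hasDerivWithinAt_nonpos
      (f' := fun s => -(2 * c * (cos s / sin s) * v s ^ 2)) (convex_Ioc _ _) ?_ ?_ ?_
    · exact fun s hs => (hE s ⟨hs.1, by linarith [hs.2, pi_pos]⟩).continuousAt.continuousWithinAt
    · intro s hs
      rw [interior_Ioc] at hs
      exact (hE s ⟨hs.1, by linarith [hs.2, pi_pos]⟩).hasDerivWithinAt
    · intro s hs
      rw [interior_Ioc] at hs
      have hcos := cos_nonneg_of_mem_Icc (x := s) ⟨by linarith [hs.1, pi_pos], hs.2.le⟩
      have hsin := sin_pos_of_pos_of_lt_pi hs.1 (by linarith [hs.2, pi_pos])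
      exact neg_nonpos.mpr (by positivity)
  refine le_antisymm (le_of_forall_pos_le_add fun ε hε => ?_) (by positivity)
  -- The mean value theorem on `[0, s]` gives points near `0` where the energy is small.
  have hu0' := hu 0 ⟨le_rfl, pi_pos⟩
  have hslope : Filter.Tendsto (fun s => (s⁻¹ * u s) ^ 2) (nhdsWithin 0 (Ioi 0)) (nhds 0) := by
    have h := (hasDerivAt_iff_tendsto_slope.mp hu0').mono_left
      (nhdsWithin_mono 0 (fun s (hs : s ∈ Ioi 0) => (mem_Ioi.mp hs).ne'))
    rw [hv0] at h
    simpa [slope_fun_def, hu0] using h.pow 2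
  have hcont : Filter.Tendsto (fun s => A * u s ^ 2) (nhds 0) (nhds 0) := by
    simpa [ContinuousAt, hu0] using (hu0'.continuousAt.pow 2).const_mul A
  obtain ⟨δ, hδ, hball⟩ := Metric.eventually_nhds_iff.mp
    (hcont.eventually (gt_mem_nhds (half_pos hε)))
  have hev : ∀ᶠ s in nhdsWithin (0 : ℝ) (Ioi 0), s ∈ Ioo 0 (min δ t) :=
    Ioo_mem_nhdsGT (lt_min hδ ht.1)
  obtain ⟨s, hs, hsmall⟩ :=
    (hev.and (hslope.eventually (gt_mem_nhds (half_pos hε)))).exists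
  have hst : s < t := hs.2.trans_le (min_le_right _ _)
  have hsδ : s < δ := hs.2.trans_le (min_le_left _ _)
  have hsub : ∀ x ∈ Icc 0 s, HasDerivAt u (v x) x := fun x hx =>
    hu x ⟨hx.1, by linarith [hx.2, ht.2, pi_pos]⟩
  obtain ⟨ξ, hξ, hvξ⟩ := exists_hasDerivAt_eq_slope u v hs.1
    (fun x hx => (hsub x hx).continuousAt.continuousWithinAt)
    (fun x hx => hsub x ⟨hx.1.le, hx.2.le⟩)
  have hle := hanti (a := ξ) (b := t) ⟨hξ.1, by linarith [hξ.2, ht.2]⟩ ht (by linarith [hξ.2])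
  have hAξ : A * u ξ ^ 2 < ε / 2 := hball (by
    rw [dist_zero_right, norm_eq_abs, abs_of_pos hξ.1]; linarith [hξ.2])
  have hvξ' : v ξ ^ 2 < ε / 2 := by
    rw [hvξ, hu0, sub_zero, sub_zero, div_eq_inv_mul]; exact hsmall
  simp only at hle
  linarith

lemma deriv_eq_zero_of_pi_div_two_le (hc : 0 ≤ c) (hA : 0 ≤ A)
    (hu : ∀ t ∈ Ioo (0 : ℝ) π, HasDerivAt u (v t) t)
    (hv : ∀ t ∈ Ioo (0 : ℝ) π, HasDerivAt v (-(c * (cos t / sin t) * v t) - A * u t) t)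
    (h0 : v (π / 2) ^ 2 + A * u (π / 2) ^ 2 = 0) {t : ℝ} (ht : t ∈ Ico (π / 2) π) :
    v t = 0 := by
  have hpos : ∀ s ∈ Ico (π / 2) π, 0 < s := fun s hs => by linarith [hs.1, pi_pos]
  have hsin : ∀ s ∈ Ico (π / 2) π, 0 < sin s := fun s hs =>
    sin_pos_of_pos_of_lt_pi (hpos s hs) hs.2
  have hE : ∀ s ∈ Ico (π / 2) π, HasDerivAt
      (fun s => sin s ^ (2 * c) * (v s ^ 2 + A * u s ^ 2))
      (sin s ^ (2 * c) * (2 * c * (cos s / sin s) * (A * u s ^ 2))) s := by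
    intro s hs
    have hs' : s ∈ Ioo 0 π := ⟨hpos s hs, hs.2⟩
    refine (((hasDerivAt_sin s).rpow_const (p := 2 * c) (Or.inl (hsin s hs).ne')).mul
      (((hv s hs').pow 2).add (((hu s hs').pow 2).const_mul A))).congr_deriv ?_
    simp only [Pi.add_apply, Pi.pow_apply]
    rw [rpow_sub_one (hsin s hs).ne']
    push_cast
    field_simp
    ring
  have hanti : AntitoneOn (fun s => sin s ^ (2 * c) * (v s ^ 2 + A * u s ^ 2))
      (Ico (π / 2) π) := by
    refine antitoneOn_of_hasDerivWithinAt_nonpos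
      (f' := fun s => sin s ^ (2 * c) * (2 * c * (cos s / sin s) * (A * u s ^ 2)))
      (convex_Ico _ _) ?_ ?_ ?_
    · exact fun s hs => (hE s hs).continuousAt.continuousWithinAt
    · exact fun s hs => (hE s (interior_subset hs)).hasDerivWithinAt
    · intro s hs
      replace hs := interior_subset hs
      have hcos : cos s ≤ 0 := cos_nonpos_of_pi_div_two_le_of_le hs.1 (by linarith [hs.2, pi_pos])
      have hcot : cos s / sin s ≤ 0 := div_nonpos_of_nonpos_of_nonneg hcos (hsin s hs).le
      have hr := rpow_nonneg (hsin s hs).le (2 * c)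
      exact mul_nonpos_of_nonneg_of_nonpos hr (mul_nonpos_of_nonpos_of_nonneg
        (mul_nonpos_of_nonneg_of_nonpos (by positivity) hcot) (by positivity))
  have hle := hanti ⟨le_rfl, by linarith [pi_pos]⟩ ht ht.1
  simp only [h0, mul_zero] at hle
  have hr := rpow_pos_of_pos (hsin t ht) (2 * c)
  have hsum : v t ^ 2 + A * u t ^ 2 ≤ 0 := nonpos_of_mul_nonpos_right hle hr
  have hAu : 0 ≤ A * u t ^ 2 := by positivity
  exact pow_eq_zero_iff two_ne_zero |>.mp (le_antisymm (by linarith) (sq_nonneg _))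

lemma eq_zero_of_linearized_equation (hc : 0 ≤ c) (hA : 0 ≤ A)
    (hu : ∀ t ∈ Icc (0 : ℝ) π, HasDerivAt u (v t) t)
    (hv : ∀ t ∈ Ioo (0 : ℝ) π, HasDerivAt v (-(c * (cos t / sin t) * v t) - A * u t) t)
    (hu0 : u 0 = 0) (hv0 : v 0 = 0) {t : ℝ} (ht : t ∈ Icc 0 π) : u t = 0 := by
  have henergy : ∀ s ∈ Ioc 0 (π / 2), v s ^ 2 + A * u s ^ 2 = 0 := fun s hs =>
    energy_eq_zero_of_le_pi_div_two hc hA (fun x hx => hu x (Ico_subset_Icc_self hx)) hv hu0 hv0 hs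
  have hv_zero : ∀ s ∈ Ioo 0 π, v s = 0 := by
    intro s hs
    rcases le_total s (π / 2) with h | h
    · have hAu : 0 ≤ A * u s ^ 2 := by positivity
      exact pow_eq_zero_iff two_ne_zero |>.mp
        (le_antisymm (by linarith [henergy s ⟨hs.1, h⟩]) (sq_nonneg _))
    · exact deriv_eq_zero_of_pi_div_two_le hc hA (fun x hx => hu x (Ioo_subset_Icc_self hx)) hv
        (henergy _ ⟨by positivity, le_rfl⟩) ⟨h, hs.2⟩
  rcases ht.1.eq_or_lt with rfl | hpos
  · exact hu0
  obtain ⟨ξ, hξ, hslope⟩ := exists_hasDerivAt_eq_slope u v hpos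
    (fun x hx => (hu x ⟨hx.1, hx.2.trans ht.2⟩).continuousAt.continuousWithinAt)
    (fun x hx => hu x ⟨hx.1.le, hx.2.le.trans ht.2⟩)
  rw [hv_zero ξ ⟨hξ.1, hξ.2.trans_le ht.2⟩, hu0, sub_zero, sub_zero, eq_comm,
    div_eq_zero_iff] at hslope
  exact hslope.resolve_right hpos.ne'

end Uniqueness

lemma hasDerivAt_aeval_cos (P : Polynomial ℚ) (t : ℝ) :
    HasDerivAt (fun s => Polynomial.aeval (cos s) P)
      (-(sin t * Polynomial.aeval (cos t) (Polynomial.derivative P))) t := by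
  refine ((P.hasDerivAt_aeval (cos t)).comp t (hasDerivAt_cos t)).congr_deriv ?_
  ring

/-- For `A = n(n+m-1)`, a normalized solution of the linearized equation is a
polynomial with rational coefficients in `cos t`, involving only the powers
`cos^j t` with `j ≤ n` and `j ≡ n (mod 2)`. -/
theorem linsol_eq_poly_cos (m n : ℕ) (hm : 2 ≤ m) (w : ℝ → ℝ)
    (hw : IsNormalizedLinSolution m ((n : ℝ) * ((n : ℝ) + (m : ℝ) - 1)) w) :
    ∃ P : Polynomial ℚ,
      (∀ t ∈ Icc (0 : ℝ) π, w t = Polynomial.aeval (Real.cos t) P) ∧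
      (∀ j : ℕ, ¬ (j ≤ n ∧ j % 2 = n % 2) → P.coeff j = 0) := by
  obtain ⟨-, hdw, hddw, hw0, hdw0, heq⟩ := hw
  refine ⟨normalizedGegenbauer m n, fun t ht => ?_, normalizedGegenbauer.coeff_eq_zero m n⟩
  set P := normalizedGegenbauer m n with hP
  have hm' : (2 : ℝ) ≤ m := by exact_mod_cast hm
  have hn : (0 : ℝ) ≤ n := n.cast_nonneg
  refine sub_eq_zero.mp (eq_zero_of_linearized_equation (c := (m : ℝ) - 1)
    (A := (n : ℝ) * ((n : ℝ) + (m : ℝ) - 1))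
    (u := fun s => w s - Polynomial.aeval (cos s) P)
    (v := fun s => deriv w s - -(sin s * Polynomial.aeval (cos s) (Polynomial.derivative P)))
    (by linarith) (mul_nonneg hn (by linarith)) ?_ ?_ ?_ ?_ ht)
  · exact fun s hs => (hdw s hs).hasDerivAt.sub (hasDerivAt_aeval_cos P s)
  · intro s hs
    have hsin : sin s ≠ 0 := (sin_pos_of_pos_of_lt_pi hs.1 hs.2).ne'
    have hode := congrArg (Polynomial.aeval (cos s))
      (normalizedGegenbauer.differential_equation m n hm)
    rw [← hP] at hode
    simp only [map_add, map_sub, map_mul, map_pow, map_one, map_zero, map_natCast,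
      Polynomial.aeval_X] at hode
    refine ((hddw s hs).hasDerivAt.sub ((hasDerivAt_sin s).mul
      (hasDerivAt_aeval_cos (Polynomial.derivative P) s)).neg).congr_deriv ?_
    have hw' := heq s hs
    have hsq := sin_sq_add_cos_sq s
    have hcot : cos s / sin s * sin s = cos s := div_mul_cancel₀ _ hsin
    linear_combination hw' - hode
      + ((m : ℝ) - 1) * Polynomial.aeval (cos s) (Polynomial.derivative P) * hcot
      - Polynomial.aeval (cos s) (Polynomial.derivative (Polynomial.derivative P)) * hsq
  · simp only [hw0, cos_zero]
    rw [Polynomial.aeval_def, Polynomial.eval₂_at_one, normalizedGegenbauer.eval_one, map_one,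
      sub_self]
  · simp [hdw0]
end

section
/- Fix integers m ≥ 2 and n ≥ 0 with n even, and set A = n(n+m−1). If w is a normalized solution of the linearized equation with parameter A, then w(π−t) = w(t) for all t ∈ [0,π]; in particular w(π) = 1, and moreover w(π/2) ≠ 0. -/
open Real Set

/-- A solution of `u'' + q (cos t / sin t) u' + A u = 0` on `(0, π)` with `q, A ≥ 0` and
`u 0 = u' 0 = 0` vanishes identically. The energy `u'² + A u²` decreases on `(0, π / 2]`, and its
product with `sin ^ (2 q)` decreases on `[π / 2, π)`. -/
theorem linearized_solution_eq_zero (q : ℕ) {A : ℝ} (hA : 0 ≤ A) {u u₁ u₂ : ℝ → ℝ}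
    (hcont : ContinuousOn u (Icc 0 π))
    (hu : ∀ t ∈ Ioo (0 : ℝ) π, HasDerivAt u (u₁ t) t)
    (hu₁ : ∀ t ∈ Ioo (0 : ℝ) π, HasDerivAt u₁ (u₂ t) t)
    (hode : ∀ t ∈ Ioo (0 : ℝ) π, u₂ t + q * (cos t / sin t) * u₁ t + A * u t = 0)
    (h₀ : u 0 = 0) (h₀' : HasDerivAt u 0 0) :
    ∀ t ∈ Icc (0 : ℝ) π, u t = 0 := by
  have hpi := Real.pi_pos
  set E : ℝ → ℝ := fun t => u₁ t ^ 2 + A * u t ^ 2 with hE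
  have hE' : ∀ t ∈ Ioo (0 : ℝ) π, HasDerivAt E (-2 * q * (cos t / sin t) * u₁ t ^ 2) t := by
    intro t ht
    refine (((hu₁ t ht).pow 2).add (((hu t ht).pow 2).const_mul A)).congr_deriv ?_
    have := hode t ht
    simp only [Nat.cast_ofNat, Nat.add_one_sub_one, pow_one]
    linear_combination 2 * u₁ t * this
  have hE_anti : AntitoneOn E (Ioc 0 (π / 2)) := by
    have hsub : ∀ t ∈ Ioc (0 : ℝ) (π / 2), t ∈ Ioo (0 : ℝ) π :=
      fun t ht => ⟨ht.1, by linarith [ht.2]⟩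
    refine antitoneOn_of_hasDerivWithinAt_nonpos (convex_Ioc _ _)
      (fun t ht => (hE' t (hsub t ht)).continuousAt.continuousWithinAt)
      (fun t ht => (hE' t (hsub t (interior_subset ht))).hasDerivWithinAt) fun t ht => ?_
    have ht := interior_subset ht
    have hs := sin_pos_of_mem_Ioo (hsub t ht)
    have hc := cos_nonneg_of_mem_Icc (x := t) ⟨by linarith [ht.1], ht.2⟩
    have : 0 ≤ 2 * q * (cos t / sin t) * u₁ t ^ 2 := by positivity
    linarith
  have hE_left : ∀ t ∈ Ioc (0 : ℝ) (π / 2), E t ≤ 0 := by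
    intro t ht
    by_contra! hpos
    set B : ℝ := 1 + A * π ^ 2 with hB
    have hBpos : 0 < B := by positivity
    set ε : ℝ := √(E t / (2 * B)) with hε
    have hεpos : 0 < ε := Real.sqrt_pos.2 (by positivity)
    have hεsq : ε ^ 2 * B = E t / 2 := by
      rw [hε, Real.sq_sqrt (by positivity)]; field_simp
    have hlo := h₀'.isLittleO.def hεpos
    obtain ⟨δ, hδ, hball⟩ := Metric.eventually_nhds_iff.1 hlo
    have hbound : ∀ s, 0 < s → s < δ → |u s| ≤ ε * s := by
      intro s hs hsδ
      have := hball (y := s) (by simpa [abs_of_pos hs] using hsδ)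
      simpa [h₀, abs_of_pos hs] using this
    set s := min (δ / 2) t with hs
    have hspos : 0 < s := lt_min (by linarith) ht.1
    have hsδ : s < δ := (min_le_left _ _).trans_lt (by linarith)
    have hst : s ≤ t := min_le_right _ _
    have hsπ : s < π := by linarith [ht.2]
    obtain ⟨ξ, hξ, hslope⟩ := exists_hasDerivAt_eq_slope u u₁ hspos
      (hcont.mono (Icc_subset_Icc_right hsπ.le))
      (fun x hx => hu x ⟨hx.1, hx.2.trans hsπ⟩)
    have h1 : |u₁ ξ| ≤ ε := by
      rw [hslope, h₀, sub_zero, sub_zero, abs_div, abs_of_pos hspos, div_le_iff₀ hspos]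
      exact hbound s hspos hsδ
    have h2 : |u ξ| ≤ ε * π := (hbound ξ hξ.1 (hξ.2.trans hsδ)).trans
      (mul_le_mul_of_nonneg_left (hξ.2.trans hsπ).le hεpos.le)
    have h3 := hE_anti ⟨hξ.1, by linarith [hξ.2, ht.2]⟩ ht (hξ.2.le.trans hst)
    have h1' : u₁ ξ ^ 2 ≤ ε ^ 2 := sq_le_sq' (neg_le_of_abs_le h1) (le_of_abs_le h1)
    have h2' : u ξ ^ 2 ≤ (ε * π) ^ 2 := sq_le_sq' (neg_le_of_abs_le h2) (le_of_abs_le h2)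
    have h4 : E ξ ≤ ε ^ 2 * B := by
      have := mul_le_mul_of_nonneg_left h2' hA
      simp only [hE, hB]
      nlinarith
    linarith
  set F : ℝ → ℝ := fun t => (sin t ^ q) ^ 2 * E t with hF
  have hsinq : ∀ t ∈ Ioo (0 : ℝ) π,
      HasDerivAt (fun t => sin t ^ q) (q * (cos t / sin t) * sin t ^ q) t := by
    intro t ht
    have hs := (sin_pos_of_mem_Ioo ht).ne'
    refine ((hasDerivAt_sin t).pow q).congr_deriv ?_
    rcases q with _ | q
    · simp
    · field_simp
      simp [pow_succ, mul_comm, mul_left_comm]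
  have hF' : ∀ t ∈ Ioo (0 : ℝ) π,
      HasDerivAt F (2 * q * (cos t / sin t) * (sin t ^ q) ^ 2 * (A * u t ^ 2)) t := by
    intro t ht
    refine (((hsinq t ht).pow 2).mul (hE' t ht)).congr_deriv ?_
    simp only [hE, Nat.cast_ofNat, Nat.add_one_sub_one, pow_one, Pi.pow_apply]
    ring
  have hF_anti : AntitoneOn F (Ico (π / 2) π) := by
    have hsub : ∀ t ∈ Ico (π / 2) π, t ∈ Ioo (0 : ℝ) π :=
      fun t ht => ⟨by linarith [ht.1], ht.2⟩
    refine antitoneOn_of_hasDerivWithinAt_nonpos (convex_Ico _ _)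
      (fun t ht => (hF' t (hsub t ht)).continuousAt.continuousWithinAt)
      (fun t ht => (hF' t (hsub t (interior_subset ht))).hasDerivWithinAt) fun t ht => ?_
    have ht := interior_subset ht
    have hs := sin_pos_of_mem_Ioo (hsub t ht)
    have hc : cos t ≤ 0 := cos_nonpos_of_pi_div_two_le_of_le ht.1 (by linarith [ht.2])
    have hcs : cos t / sin t ≤ 0 := div_nonpos_of_nonpos_of_nonneg hc hs.le
    have : 0 ≤ 2 * (q : ℝ) * (sin t ^ q) ^ 2 * (A * u t ^ 2) := by positivity
    nlinarith
  have hE_nonpos : ∀ t ∈ Ioo (0 : ℝ) π, E t ≤ 0 := by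
    intro t ht
    rcases le_total t (π / 2) with h | h
    · exact hE_left t ⟨ht.1, h⟩
    · have hle := hF_anti ⟨le_rfl, by linarith⟩ ⟨h, ht.2⟩ h
      have hmid := hE_left (π / 2) ⟨by linarith, le_rfl⟩
      have hs : 0 < (sin t ^ q) ^ 2 := by have := sin_pos_of_mem_Ioo ht; positivity
      simp only [hF, sin_pi_div_two, one_pow, one_mul] at hle
      exact nonpos_of_mul_nonpos_right (hle.trans hmid) hs
  have hu₁_zero : ∀ t ∈ Ioo (0 : ℝ) π, u₁ t = 0 := by
    intro t ht
    have h := hE_nonpos t ht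
    have : 0 ≤ A * u t ^ 2 := by positivity
    simp only [hE] at h
    exact pow_eq_zero_iff two_ne_zero |>.1 (le_antisymm (by linarith) (sq_nonneg _))
  intro t ht
  rcases ht.1.eq_or_lt with rfl | htpos
  · exact h₀
  obtain ⟨ξ, hξ, hslope⟩ := exists_hasDerivAt_eq_slope u u₁ htpos
    (hcont.mono (Icc_subset_Icc_right ht.2)) (fun x hx => hu x ⟨hx.1, hx.2.trans_le ht.2⟩)
  rw [hu₁_zero ξ ⟨hξ.1, hξ.2.trans_le ht.2⟩, h₀, sub_zero, sub_zero, eq_comm,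
    div_eq_zero_iff] at hslope
  exact hslope.resolve_right htpos.ne'

open Polynomial in
/-- Truncations of the even power series solution of `(1 - x²) p'' - m x p' + A p = 0`
satisfy the equation up to a multiple of the leading monomial. -/
theorem exists_even_polynomial_gegenbauer_truncated (m A : ℝ) (N : ℕ) :
    ∃ (p : ℝ[X]) (c : ℝ), p.eval 0 = 1 ∧ (∀ x, p.eval (-x) = p.eval x) ∧
      ∀ x, (1 - x ^ 2) * p.derivative.derivative.eval x - m * x * p.derivative.eval x
        + A * p.eval x = (A - 2 * N * (2 * N + m - 1)) * c * x ^ (2 * N) := by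
  induction N with
  | zero => exact ⟨1, 1, by simp⟩
  | succ N ih =>
    obtain ⟨p, c, hp0, hpe, hp⟩ := ih
    set d : ℝ := -((A - 2 * N * (2 * N + m - 1)) * c) / ((2 * N + 2) * (2 * N + 1)) with hd
    have hd' : d * ((2 * N + 2) * (2 * N + 1)) = -((A - 2 * N * (2 * N + m - 1)) * c) := by
      rw [hd, div_mul_cancel₀]; positivity
    refine ⟨p + C d * X ^ (2 * N + 2), d, by simp [hp0], fun x => ?_, fun x => ?_⟩
    · have : Even (2 * N + 2) := ⟨N + 1, by ring⟩
      simp [hpe, this.neg_pow]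
    · have := hp x
      simp [derivative_X_pow_succ]
      linear_combination this + x ^ (2 * N) * hd'

open Polynomial in
/-- For `A = n (n + m - 1)` with `n` even, `(1 - x²) p'' - m x p' + A p = 0` has an even polynomial
solution with `p 0 = 1`. -/
theorem exists_even_polynomial_gegenbauer (m : ℝ) {n : ℕ} (hn : Even n) :
    ∃ p : ℝ[X], p.eval 0 = 1 ∧ (∀ x, p.eval (-x) = p.eval x) ∧
      ∀ x, (1 - x ^ 2) * p.derivative.derivative.eval x - m * x * p.derivative.eval x
        + n * (n + m - 1) * p.eval x = 0 := by
  obtain ⟨N, rfl⟩ := hn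
  obtain ⟨p, c, hp0, hpe, hp⟩ := exists_even_polynomial_gegenbauer_truncated m
    ((N + N : ℕ) * ((N + N : ℕ) + m - 1)) N
  refine ⟨p, hp0, hpe, fun x => (hp x).trans ?_⟩
  push_cast
  ring

/-- For even `n` and `A = n(n+m-1)`, a normalized solution of the linearized
equation is symmetric about `t = π/2`; in particular `w π = 1`, and moreover
`w (π/2) ≠ 0`. -/
theorem linsol_symmetric_of_even (m n : ℕ) (hm : 2 ≤ m) (hn : Even n)
    (w : ℝ → ℝ)
    (hw : IsNormalizedLinSolution m ((n : ℝ) * ((n : ℝ) + (m : ℝ) - 1)) w) :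
    (∀ t ∈ Icc (0 : ℝ) π, w (π - t) = w t) ∧ w π = 1 ∧ w (π / 2) ≠ 0 := by
  have hpi := Real.pi_pos
  obtain ⟨hcont, hd, hdd, hw0, hw0', hode⟩ := hw
  obtain ⟨p, hp0, hpe, hp⟩ := exists_even_polynomial_gegenbauer (m : ℝ) hn
  obtain ⟨q, rfl⟩ : ∃ q, m = q + 1 := ⟨m - 1, by omega⟩
  have hv : ∀ t, HasDerivAt (fun t => p.eval (cos t)) (p.derivative.eval (cos t) * -sin t) t :=
    fun t => (p.hasDerivAt (cos t)).comp t (hasDerivAt_cos t)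
  have hv₁ : ∀ t, HasDerivAt (fun t => p.derivative.eval (cos t) * -sin t)
      (p.derivative.derivative.eval (cos t) * -sin t * -sin t
        + p.derivative.eval (cos t) * -cos t) t :=
    fun t => ((p.derivative.hasDerivAt (cos t)).comp t (hasDerivAt_cos t)).mul
      (hasDerivAt_sin t).neg
  set κ : ℝ := p.eval 1 with hκ
  have hA : (0 : ℝ) ≤ n * (n + (q + 1 : ℕ) - 1) := by
    push_cast
    have : (n : ℝ) * (n + (q + 1) - 1) = n * (n + q) := by ring
    rw [this]; positivity
  have hzero : ∀ t ∈ Icc (0 : ℝ) π, κ * w t - p.eval (cos t) = 0 := by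
    refine linearized_solution_eq_zero q hA (u := fun t => κ * w t - p.eval (cos t))
      ((hcont.const_mul κ).sub fun t _ => (hv t).continuousAt.continuousWithinAt)
      (fun t ht => ((hd t (Ioo_subset_Icc_self ht)).hasDerivAt.const_mul κ).sub (hv t))
      (fun t ht => ((hdd t ht).hasDerivAt.const_mul κ).sub (hv₁ t)) (fun t ht => ?_)
      (by simp [hw0, hκ]) ?_
    · have hs := (sin_pos_of_mem_Ioo ht).ne'
      have h1 := hode t ht
      have h2 := hp (cos t)
      have h3 : cos t / sin t * sin t = cos t := div_mul_cancel₀ _ hs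
      push_cast at h1 h2 ⊢
      linear_combination κ * h1 - h2 - (p.derivative.derivative.eval (cos t)) * sin_sq_add_cos_sq t
        + q * p.derivative.eval (cos t) * h3
    · have := ((hd 0 ⟨le_rfl, hpi.le⟩).hasDerivAt.const_mul κ).sub (hv 0)
      exact this.congr_deriv (by simp [hw0'])
  have hmid : κ * w (π / 2) = 1 := by
    have := hzero (π / 2) ⟨by linarith, by linarith⟩
    rw [cos_pi_div_two, hp0] at this
    linarith
  have hsymm : ∀ t ∈ Icc (0 : ℝ) π, w (π - t) = w t := by
    intro t ht
    have h1 := hzero t ht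
    have h2 := hzero (π - t) ⟨by linarith [ht.2], by linarith [ht.1]⟩
    rw [cos_pi_sub, hpe] at h2
    exact mul_left_cancel₀ (left_ne_zero_of_mul_eq_one hmid) (by linarith)
  refine ⟨hsymm, ?_, right_ne_zero_of_mul_eq_one hmid⟩
  simpa [hw0] using hsymm 0 ⟨le_rfl, hpi.le⟩
end

section
/- Fix integers m ≥ 2 and n ≥ 1 with n odd, and set A = n(n+m−1). If w is a normalized solution of the linearized equation with parameter A, then w(π−t) = −w(t) for all t ∈ [0,π]; in particular w(π) = −1 and w(π/2) = 0. -/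
open Real Set

open Polynomial in
/-- The odd power-series solution at `0` of the Gegenbauer equation, truncated at degree `2 * N + 1`,
together with the remainder produced by the truncation. -/
theorem exists_odd_gegenbauer_truncation (l μ : ℝ) (N : ℕ) :
    ∃ (P : ℝ[X]) (c : ℝ), (∀ x, P.eval (-x) = -P.eval x) ∧ P.derivative.eval 0 = 1 ∧
      ∀ x, (1 - x ^ 2) * P.derivative.derivative.eval x - μ * x * P.derivative.eval x
        + l * P.eval x = c * (l - (2 * N + 1) * (2 * N + μ)) * x ^ (2 * N + 1) := by
  induction N with
  | zero =>
    refine ⟨X, 1, by simp, by simp, fun x => ?_⟩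
    simp
    ring
  | succ N ih =>
    obtain ⟨P, c, hodd, hder, hode⟩ := ih
    set b : ℝ := -(c * (l - (2 * N + 1) * (2 * N + μ))) / ((2 * N + 3) * (2 * N + 2)) with hb
    have hb' : b * ((2 * N + 3) * (2 * N + 2)) = -(c * (l - (2 * N + 1) * (2 * N + μ))) := by
      rw [hb]; field_simp
    have h1 (x : ℝ) : (C b * X ^ (2 * N + 3) : ℝ[X]).derivative.eval x
        = b * (2 * N + 3) * x ^ (2 * N + 2) := by
      simp ; ring
    have h2 (x : ℝ) : (C b * X ^ (2 * N + 3) : ℝ[X]).derivative.derivative.eval x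
        = b * (2 * N + 3) * (2 * N + 2) * x ^ (2 * N + 1) := by
      simp ; ring
    refine ⟨P + C b * X ^ (2 * N + 3), b, fun x => ?_, ?_, fun x => ?_⟩
    · have : (-x) ^ (2 * N + 3) = -x ^ (2 * N + 3) := Odd.neg_pow ⟨N + 1, by ring⟩ x
      simp only [eval_add, eval_mul, eval_C, eval_pow, eval_X, hodd, this]
      ring
    · rw [derivative_add, eval_add, h1, hder]
      simp
    · rw [derivative_add, derivative_add, eval_add, eval_add, eval_add, h1, h2]
      simp only [eval_mul, eval_C, eval_pow, eval_X]
      push_cast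
      linear_combination hode x + x ^ (2 * N + 1) * hb'

/-- For odd `n` the Gegenbauer equation has a nonzero odd polynomial solution. -/
theorem exists_odd_gegenbauer_polynomial (μ : ℝ) {n : ℕ} (hn : Odd n) :
    ∃ P : Polynomial ℝ, (∀ x, P.eval (-x) = -P.eval x) ∧ P.derivative.eval 0 = 1 ∧
      ∀ x, (1 - x ^ 2) * P.derivative.derivative.eval x - μ * x * P.derivative.eval x
        + n * (n + μ - 1) * P.eval x = 0 := by
  obtain ⟨N, rfl⟩ := hn
  obtain ⟨P, c, hodd, hder, hode⟩ :=
    exists_odd_gegenbauer_truncation ((2 * N + 1) * (2 * N + μ)) μ N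
  refine ⟨P, hodd, hder, fun x => ?_⟩
  have := hode x
  push_cast
  linear_combination this

/-- A function with value and derivative `0` at `0` has arbitrarily small first-order data
arbitrarily close to `0` on the right. -/
theorem exists_small_deriv_of_hasDerivAt_zero {v v' : ℝ → ℝ} {s : ℝ} (hs : 0 < s)
    (h0 : v 0 = 0) (hd0 : HasDerivAt v 0 0) (hd : ∀ t ∈ Ioo 0 s, HasDerivAt v (v' t) t)
    {δ : ℝ} (hδ : 0 < δ) :
    ∃ t ∈ Ioo 0 s, |v' t| ≤ δ ∧ |v t| ≤ δ := by
  have hlittle := hd0.isLittleO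
  simp only [h0, sub_zero, smul_zero] at hlittle
  have hev := hlittle.def hδ
  obtain ⟨r, hr, hball⟩ := Metric.eventually_nhds_iff.1 hev
  set t := min (min (r / 2) (s / 2)) 1 with ht
  have ht0 : 0 < t := by positivity
  have htr : t < r := by
    have : t ≤ r / 2 := (min_le_left _ _).trans (min_le_left _ _)
    linarith
  have hts : t < s := by
    have : t ≤ s / 2 := (min_le_left _ _).trans (min_le_right _ _)
    linarith
  have ht1 : t ≤ 1 := min_le_right _ _
  have hbound (x : ℝ) (hx : 0 < x) (hxt : x ≤ t) : |v x| ≤ δ * x := by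
    have := hball (y := x) (by rw [Real.dist_eq, sub_zero, abs_of_pos hx]; linarith)
    simpa [abs_of_pos hx] using this
  have hcont : ContinuousOn v (Icc 0 t) := by
    intro x hx
    rcases hx.1.eq_or_lt with rfl | hx0
    · exact hd0.continuousAt.continuousWithinAt
    · exact (hd x ⟨hx0, hx.2.trans_lt hts⟩).continuousAt.continuousWithinAt
  obtain ⟨ξ, hξ, hξd⟩ := exists_hasDerivAt_eq_slope v v' ht0 hcont
    fun x hx => hd x ⟨hx.1, hx.2.trans hts⟩
  refine ⟨ξ, ⟨hξ.1, hξ.2.trans hts⟩, ?_, ?_⟩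
  · rw [hξd, h0, sub_zero, sub_zero, abs_div, abs_of_pos ht0, div_le_iff₀ ht0]
    exact hbound t ht0 le_rfl
  · have := hbound ξ hξ.1 hξ.2.le
    nlinarith [hξ.2]

/-- Uniqueness for the singular initial value problem at `0`. -/
theorem linearized_eq_zero_of_initial_zero {k : ℕ} {A : ℝ} (hA : 0 < A) {v v' v'' : ℝ → ℝ}
    (hcont : ContinuousOn v (Icc 0 π)) (h0 : v 0 = 0) (hd0 : HasDerivAt v 0 0)
    (hd : ∀ t ∈ Ioo 0 π, HasDerivAt v (v' t) t)
    (hdd : ∀ t ∈ Ioo 0 π, HasDerivAt v' (v'' t) t)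
    (hode : ∀ t ∈ Ioo 0 π, v'' t + k * (cos t / sin t) * v' t + A * v t = 0) :
    ∀ t ∈ Icc 0 π, v t = 0 := by
  set E : ℝ → ℝ := fun t => v' t ^ 2 + A * v t ^ 2 with hE
  have hpi := Real.pi_pos
  have hEd (t : ℝ) (ht : t ∈ Ioo 0 π) :
      HasDerivAt E (-(2 * k * (cos t / sin t) * v' t ^ 2)) t := by
    have h := ((hdd t ht).pow 2).add (((hd t ht).pow 2).const_mul A)
    refine h.congr_deriv ?_
    push_cast
    linear_combination 2 * v' t * hode t ht
  have hEzero (t : ℝ) (h : E t ≤ 0) : v t = 0 := by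
    have h1 : A * v t ^ 2 ≤ 0 := by
      have : E t = v' t ^ 2 + A * v t ^ 2 := rfl
      nlinarith [sq_nonneg (v' t)]
    have h2 : v t ^ 2 ≤ 0 := by
      by_contra! h3
      nlinarith [mul_pos hA h3]
    exact pow_eq_zero_iff two_ne_zero |>.1 (le_antisymm h2 (sq_nonneg _))
  have hanti : AntitoneOn E (Ioc 0 (π / 2)) := by
    have hsub (t : ℝ) (ht : t ∈ Ioc 0 (π / 2)) : t ∈ Ioo 0 π := ⟨ht.1, by linarith [ht.2]⟩
    refine antitoneOn_of_hasDerivWithinAt_nonpos (convex_Ioc _ _)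
      (fun t ht => (hEd t (hsub t ht)).continuousAt.continuousWithinAt)
      (fun t ht => (hEd t (hsub t (interior_subset ht))).hasDerivWithinAt) fun t ht => ?_
    have ht := interior_subset ht
    have hs : 0 < sin t := sin_pos_of_mem_Ioo (hsub t ht)
    have hc : 0 ≤ cos t := cos_nonneg_of_mem_Icc ⟨by linarith [ht.1], ht.2⟩
    rw [neg_nonpos]
    positivity
  have hfirst (t : ℝ) (ht : t ∈ Ioc 0 (π / 2)) : E t ≤ 0 := by
    refine le_of_forall_pos_le_add fun ε hε => ?_
    have hδ : 0 < √(ε / (1 + A)) := by positivity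
    obtain ⟨ξ, hξ, hξ1, hξ2⟩ := exists_small_deriv_of_hasDerivAt_zero ht.1 h0 hd0
      (fun x hx => hd x ⟨hx.1, by linarith [hx.2, ht.2]⟩) hδ
    have hle := hanti ⟨hξ.1, hξ.2.le.trans ht.2⟩ ht hξ.2.le
    have hsq : √(ε / (1 + A)) ^ 2 = ε / (1 + A) := Real.sq_sqrt (by positivity)
    have h1 : v' ξ ^ 2 ≤ ε / (1 + A) := by
      rw [← hsq, ← sq_abs]; gcongr
    have h2 : v ξ ^ 2 ≤ ε / (1 + A) := by
      rw [← hsq, ← sq_abs (v ξ)]; gcongr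
    calc E t ≤ v' ξ ^ 2 + A * v ξ ^ 2 := hle
      _ ≤ ε / (1 + A) + A * (ε / (1 + A)) := by gcongr
      _ = 0 + ε := by field_simp; ring
  have hFanti : AntitoneOn (fun t => sin t ^ (2 * k) * E t) (Ico (π / 2) π) := by
    have hsub (t : ℝ) (ht : t ∈ Ico (π / 2) π) : t ∈ Ioo 0 π := ⟨by linarith [ht.1], ht.2⟩
    have hFd (t : ℝ) (ht : t ∈ Ico (π / 2) π) :
        HasDerivAt (fun t => sin t ^ (2 * k) * E t)
          (sin t ^ (2 * k) * (2 * k * (cos t / sin t) * (A * v t ^ 2))) t := by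
      have hs : 0 < sin t := sin_pos_of_mem_Ioo (hsub t ht)
      refine (((hasDerivAt_sin t).pow (2 * k)).mul (hEd t (hsub t ht))).congr_deriv ?_
      have hpow : (2 * k : ℕ) * sin t ^ (2 * k - 1) * cos t
          = sin t ^ (2 * k) * (2 * k * (cos t / sin t)) := by
        rcases Nat.eq_zero_or_pos k with rfl | hk
        · simp
        · obtain ⟨j, hj⟩ : ∃ j, 2 * k = j + 1 := ⟨2 * k - 1, by omega⟩
          have hj' : (2 * k : ℝ) = ((j + 1 : ℕ) : ℝ) := by exact_mod_cast hj
          rw [hj', hj, Nat.add_sub_cancel, pow_succ]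
          field_simp
      simp only [Pi.pow_apply]
      rw [hpow, hE]
      ring
    refine antitoneOn_of_hasDerivWithinAt_nonpos (convex_Ico _ _)
      (fun t ht => (hFd t ht).continuousAt.continuousWithinAt)
      (fun t ht => (hFd t (interior_subset ht)).hasDerivWithinAt) fun t ht => ?_
    have ht := interior_subset ht
    have hs : 0 < sin t := sin_pos_of_mem_Ioo (hsub t ht)
    have hc : cos t ≤ 0 := cos_nonpos_of_pi_div_two_le_of_le ht.1 (by linarith [ht.2])
    refine mul_nonpos_of_nonneg_of_nonpos (by positivity)
      (mul_nonpos_of_nonpos_of_nonneg ?_ (by positivity))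
    exact mul_nonpos_of_nonneg_of_nonpos (by positivity) (div_nonpos_of_nonpos_of_nonneg hc hs.le)
  have hsecond (t : ℝ) (ht : t ∈ Ico (π / 2) π) : E t ≤ 0 := by
    have hle := hFanti ⟨le_rfl, by linarith⟩ ht ht.1
    have hmid := hfirst (π / 2) ⟨by linarith, le_rfl⟩
    simp only [sin_pi_div_two, one_pow, one_mul] at hle
    have hs : 0 < sin t ^ (2 * k) :=
      pow_pos (sin_pos_of_mem_Ioo ⟨by linarith [ht.1], ht.2⟩) _
    by_contra! hpos
    linarith [mul_pos hs hpos]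
  have hIoo : EqOn v (fun _ => 0) (Ioo 0 π) := fun t ht => by
    rcases le_total t (π / 2) with h | h
    · exact hEzero t (hfirst t ⟨ht.1, h⟩)
    · exact hEzero t (hsecond t ⟨h, ht.2⟩)
  exact hIoo.of_subset_closure hcont continuousOn_const Ioo_subset_Icc_self
    (closure_Ioo hpi.ne).ge

/-- A polynomial solution of the Gegenbauer equation, composed with `cos`, is proportional to any
solution of the linearized equation with vanishing derivative at `0`. -/
theorem eval_one_mul_eq_mul_eval_cos {m : ℕ} (hm : 1 ≤ m) {A : ℝ} (hA : 0 < A)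
    {P : Polynomial ℝ}
    (hP : ∀ x, (1 - x ^ 2) * P.derivative.derivative.eval x - m * x * P.derivative.eval x
        + A * P.eval x = 0)
    {w w' w'' : ℝ → ℝ} (hcont : ContinuousOn w (Icc 0 π)) (hd0 : HasDerivAt w 0 0)
    (hd : ∀ t ∈ Ioo 0 π, HasDerivAt w (w' t) t)
    (hdd : ∀ t ∈ Ioo 0 π, HasDerivAt w' (w'' t) t)
    (hode : ∀ t ∈ Ioo 0 π, w'' t + ((m : ℝ) - 1) * (cos t / sin t) * w' t + A * w t = 0) :
    ∀ t ∈ Icc 0 π, P.eval 1 * w t = w 0 * P.eval (cos t) := by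
  have hq (Q : Polynomial ℝ) (t : ℝ) : HasDerivAt (fun t => Q.eval (cos t))
      (Q.derivative.eval (cos t) * -sin t) t :=
    (Q.hasDerivAt (cos t)).comp t (hasDerivAt_cos t)
  intro t ht
  refine sub_eq_zero.1 (linearized_eq_zero_of_initial_zero (k := m - 1) hA
    (v := fun t => P.eval 1 * w t - w 0 * P.eval (cos t))
    (v' := fun t => P.eval 1 * w' t - w 0 * (P.derivative.eval (cos t) * -sin t))
    (v'' := fun t => P.eval 1 * w'' t - w 0 *
      (P.derivative.derivative.eval (cos t) * -sin t * -sin t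
        + P.derivative.eval (cos t) * -cos t))
    ?_ ?_ ?_ (fun t ht => ?_) (fun t ht => ?_) (fun t ht => ?_) t ht)
  · exact (continuousOn_const.mul hcont).sub (by fun_prop)
  · simp only [cos_zero]; ring
  · refine ((hd0.const_mul _).sub ((hq P 0).const_mul (w 0))).congr_deriv ?_
    simp
  · exact ((hd t ht).const_mul _).sub ((hq P t).const_mul _)
  · exact ((hdd t ht).const_mul _).sub
      (((hq P.derivative t).mul (hasDerivAt_sin t).neg).const_mul _)
  · have hs : sin t ≠ 0 := (sin_pos_of_mem_Ioo ht).ne'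
    have hcs : cos t / sin t * sin t = cos t := div_mul_cancel₀ _ hs
    have hsq := sin_sq t
    rw [Nat.cast_sub hm, Nat.cast_one]
    linear_combination P.eval 1 * hode t ht - w 0 * hP (cos t)
      + w 0 * ((m : ℝ) - 1) * P.derivative.eval (cos t) * hcs
      - w 0 * P.derivative.derivative.eval (cos t) * hsq

/-- For odd `n` and `A = n(n+m-1)`, a normalized solution of the linearized
equation is antisymmetric about `t = π/2`; in particular `w π = -1` and
`w (π/2) = 0`. -/
theorem linsol_antisymmetric_of_odd (m n : ℕ) (hm : 2 ≤ m) (hn1 : 1 ≤ n)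
    (hn : Odd n) (w : ℝ → ℝ)
    (hw : IsNormalizedLinSolution m ((n : ℝ) * ((n : ℝ) + (m : ℝ) - 1)) w) :
    (∀ t ∈ Icc (0 : ℝ) π, w (π - t) = - w t) ∧ w π = -1 ∧ w (π / 2) = 0 := by
  obtain ⟨hcont, hdiff, hdiff2, hw0, hdw0, hode⟩ := hw
  have hpi := Real.pi_pos
  have hn1' : (1 : ℝ) ≤ n := by exact_mod_cast hn1
  have hm' : (2 : ℝ) ≤ m := by exact_mod_cast hm
  have hA : 0 < (n : ℝ) * ((n : ℝ) + (m : ℝ) - 1) := mul_pos (by linarith) (by linarith)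
  obtain ⟨P, hodd, hder, hP⟩ := exists_odd_gegenbauer_polynomial (m : ℝ) hn
  have hprop : ∀ t ∈ Icc 0 π, P.eval 1 * w t = w 0 * P.eval (cos t) :=
    eval_one_mul_eq_mul_eval_cos (by omega) hA hP hcont
      ((hdiff 0 ⟨le_rfl, hpi.le⟩).hasDerivAt.congr_deriv hdw0)
      (fun t ht => (hdiff t (Ioo_subset_Icc_self ht)).hasDerivAt)
      (fun t ht => (hdiff2 t ht).hasDerivAt) hode
  have hP1 : P.eval 1 ≠ 0 := by
    intro h1
    have hroots : Icc (-1 : ℝ) 1 ⊆ {x | P.IsRoot x} := fun x hx => by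
      have := hprop (arccos x) ⟨arccos_nonneg x, arccos_le_pi x⟩
      rw [h1, hw0, cos_arccos hx.1 hx.2] at this
      simpa using this.symm
    have hP0 : P = 0 :=
      P.eq_zero_of_infinite_isRoot ((Icc_infinite (by norm_num)).mono hroots)
    simp [hP0] at hder
  have hanti : ∀ t ∈ Icc (0 : ℝ) π, w (π - t) = - w t := fun t ht => by
    have h1 := hprop t ht
    have h2 := hprop (π - t) ⟨by linarith [ht.2], by linarith [ht.1]⟩
    rw [cos_pi_sub, hodd] at h2
    exact mul_left_cancel₀ hP1 (by linear_combination h1 + h2)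
  refine ⟨hanti, ?_, ?_⟩
  · simpa [hw0] using hanti 0 ⟨le_rfl, hpi.le⟩
  · have := hanti (π / 2) ⟨by linarith, by linarith⟩
    rw [sub_half] at this
    linarith
end

section
/- Fix integers m ≥ 2 and n ≥ 0, and set A = n(n+m−1). If w is a normalized solution of the linearized equation with parameter A, then the set {t ∈ (0,π) : w(t) = 0} is finite and has exactly n elements. -/
open Real Set

open Polynomial in
/-- For `m ≥ 1` the Gegenbauer-type equation `(1 - X²) P'' - m X P' + n (n + m - 1) P = 0` has a
polynomial solution of degree at most `n` with only simple zeros in `(-1, 1)`, `n` in number. -/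
theorem exists_gegenbauer_solution (n m : ℕ) (hm : 1 ≤ m) :
    ∃ P : ℝ[X], P.natDegree ≤ n ∧
      (∀ x, (1 - x ^ 2) * P.derivative.derivative.eval x - m * x * P.derivative.eval x
        + (n : ℝ) * ((n : ℝ) + (m : ℝ) - 1) * P.eval x = 0) ∧
      (∀ x ∈ Ioo (-1 : ℝ) 1, P.eval x = 0 → P.derivative.eval x ≠ 0) ∧
      ∃ Z : Finset ℝ, Z.card = n ∧ ∀ x, x ∈ Z ↔ x ∈ Ioo (-1 : ℝ) 1 ∧ P.eval x = 0 := by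
  induction n generalizing m with
  | zero => exact ⟨1, by simp, by simp, by simp, ∅, by simp⟩
  | succ n ih =>
    obtain ⟨Q, hdeg, hode, hsimple, Z, hZcard, hZ⟩ := ih (m + 2) (by omega)
    obtain ⟨A, hA⟩ : ∃ A : ℝ, A = ((n : ℝ) + 1) * (n + m) := ⟨_, rfl⟩
    have hm' : (1 : ℝ) ≤ m := by exact_mod_cast hm
    have hApos : 0 < A := by rw [hA]; positivity
    obtain ⟨P, hP⟩ : ∃ P : ℝ[X],
        P = C (-A⁻¹) * ((1 - X ^ 2) * Q.derivative - C (m : ℝ) * X * Q) := ⟨_, rfl⟩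
    have hPeval (x : ℝ) : A * P.eval x = m * x * Q.eval x - (1 - x ^ 2) * Q.derivative.eval x := by
      simp only [hP, eval_mul, eval_sub, eval_C, eval_one, eval_pow, eval_X]
      field_simp
      ring
    have hPder : P.derivative = Q := by
      refine Polynomial.funext fun x => ?_
      have := hode x
      push_cast at this
      simp only [hP, derivative_mul, derivative_sub, derivative_one, derivative_X_pow,
        derivative_C, derivative_X, eval_mul, eval_sub, eval_C, eval_one, eval_pow, eval_X,
        eval_add, eval_zero]
      field_simp
      rw [hA]
      norm_num
      linear_combination -this
    have hPsimple : ∀ x ∈ Ioo (-1 : ℝ) 1, P.eval x = 0 → P.derivative.eval x ≠ 0 := by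
      intro x hx h0 h1
      rw [hPder] at h1
      have := hPeval x
      rw [h0, h1] at this
      have hx2 : 1 - x ^ 2 ≠ 0 := by nlinarith [hx.1, hx.2]
      refine hsimple x hx h1 ?_
      simpa [hx2] using this
    have hP0 : P ≠ 0 := by
      rintro rfl
      exact hPsimple 0 (by norm_num) (by simp) (by simp)
    have hPdeg : P.natDegree ≤ n + 1 := by
      have := P.natDegree_derivative
      rw [hPder] at this
      omega
    refine ⟨P, hPdeg, ?_, hPsimple, P.roots.toFinset.filter (· ∈ Ioo (-1 : ℝ) 1), ?_, ?_⟩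
    · intro x
      rw [hPder]
      have := hPeval x
      push_cast
      rw [hA] at this
      linear_combination this
    · refine le_antisymm ?_ ?_
      · calc _ ≤ P.roots.toFinset.card := Finset.card_filter_le _ _
          _ ≤ P.roots.card := P.roots.toFinset_card_le
          _ ≤ P.natDegree := P.card_roots'
          _ ≤ n + 1 := hPdeg
      · have hcard : (insert (-1) (insert 1 Z)).card = n + 2 := by
          rw [Finset.card_insert_of_notMem, Finset.card_insert_of_notMem, hZcard]
          · simp [hZ]
          · simp [hZ]; norm_num
        have := Finset.card_le_of_interleaved (s := insert (-1) (insert 1 Z))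
          (t := P.roots.toFinset.filter (· ∈ Ioo (-1 : ℝ) 1)) ?_
        · omega
        intro x hx y hy hxy hcons
        obtain ⟨R, hR⟩ : ∃ R : ℝ[X], R = (1 - X ^ 2) ^ m * Q ^ 2 := ⟨_, rfl⟩
        have hRz : ∀ z ∈ insert (-1) (insert 1 Z), z ∈ Icc (-1 : ℝ) 1 ∧ R.eval z = 0 := by
          intro z hz
          simp only [Finset.mem_insert, hZ] at hz
          rcases hz with rfl | rfl | ⟨hz, h0⟩
          · simp [hR]; omega
          · simp [hR]; omega
          · exact ⟨Ioo_subset_Icc_self hz, by simp [hR, h0]⟩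
        obtain ⟨z, hz, hz0⟩ := exists_deriv_eq_zero hxy R.continuous.continuousOn
          ((hRz x hx).2.trans (hRz y hy).2.symm)
        have hzI : z ∈ Ioo (-1 : ℝ) 1 :=
          ⟨(hRz x hx).1.1.trans_lt hz.1, hz.2.trans_le (hRz y hy).1.2⟩
        have hzQ : Q.eval z ≠ 0 := fun h => hcons z
          (Finset.mem_insert_of_mem (Finset.mem_insert_of_mem ((hZ z).2 ⟨hzI, h⟩))) hz
        have hz2 : 1 - z ^ 2 ≠ 0 := by nlinarith [hzI.1, hzI.2]
        refine ⟨z, ?_, hz.1, hz.2⟩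
        simp only [Finset.mem_filter, Multiset.mem_toFinset, mem_roots hP0, IsRoot.def]
        refine ⟨?_, hzI⟩
        obtain ⟨k, rfl⟩ := Nat.exists_eq_add_of_le' hm
        have hprod : -2 * (1 - z ^ 2) ^ k * Q.eval z * A * P.eval z = 0 := by
          rw [Polynomial.deriv] at hz0
          simp [hR, derivative_pow] at hz0
          have := hPeval z
          push_cast at this
          linear_combination (-2 * (1 - z ^ 2) ^ k * Q.eval z) * this + hz0
        simpa [hz2, hzQ, hApos.ne'] using hprod
    · intro x
      simp [mem_roots hP0, and_comm]

/-- There are points tending to `a` from the right along which the derivative of `f` tends to its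
value at `a`, even if the derivative is not continuous at `a`. -/
theorem exists_seq_tendsto_deriv {f : ℝ → ℝ} {a b : ℝ} (hab : a < b)
    (hf : ∀ t ∈ Ico a b, DifferentiableAt ℝ f t) :
    ∃ ξ : ℕ → ℝ, (∀ i, ξ i ∈ Ioo a b) ∧ Filter.Tendsto ξ Filter.atTop (nhds a) ∧
      Filter.Tendsto (fun i => deriv f (ξ i)) Filter.atTop (nhds (deriv f a)) := by
  obtain ⟨s, -, hs, hlim⟩ := exists_seq_strictAnti_tendsto' hab
  have hmvt (i : ℕ) : ∃ c ∈ Ioo a (s i), deriv f c = slope f a (s i) := by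
    rw [slope_def_field]
    refine exists_deriv_eq_slope f (hs i).1 (fun t ht => ?_) (fun t ht => ?_)
    · exact (hf t ⟨ht.1, ht.2.trans_lt (hs i).2⟩).continuousAt.continuousWithinAt
    · exact (hf t ⟨ht.1.le, ht.2.trans (hs i).2⟩).differentiableWithinAt
  choose ξ hξ hslope using hmvt
  refine ⟨ξ, fun i => ⟨(hξ i).1, (hξ i).2.trans (hs i).2⟩,
    tendsto_of_tendsto_of_tendsto_of_le_of_le tendsto_const_nhds hlim
      (fun i => (hξ i).1.le) (fun i => (hξ i).2.le), ?_⟩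
  simp only [hslope]
  exact (hf a ⟨le_rfl, hab⟩).hasDerivAt.tendsto_slope.comp
    (tendsto_nhdsWithin_iff.2 ⟨hlim, Filter.Eventually.of_forall fun i => (hs i).1.ne'⟩)

/-- On `(0, π)`, a normalized solution is a nonzero multiple of any solution that is twice
differentiable on the whole line and has only simple zeros in `(0, π)`. -/
theorem IsNormalizedLinSolution.exists_eq_mul {m : ℕ} (hm : 2 ≤ m) {A : ℝ} {w u u' u'' : ℝ → ℝ}
    (hw : IsNormalizedLinSolution m A w) (hu : ∀ t, HasDerivAt u (u' t) t)
    (hu' : ∀ t, HasDerivAt u' (u'' t) t)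
    (hode : ∀ t ∈ Ioo (0 : ℝ) π,
      u'' t + ((m : ℝ) - 1) * (Real.cos t / Real.sin t) * u' t + A * u t = 0)
    (hsimple : ∀ t ∈ Ioo (0 : ℝ) π, u t = 0 → u' t ≠ 0) :
    ∃ c : ℝ, c ≠ 0 ∧ ∀ t ∈ Ioo (0 : ℝ) π, w t = c * u t := by
  obtain ⟨-, hd, hd', hw0, -, hwode⟩ := hw
  obtain ⟨k, rfl⟩ := Nat.exists_eq_add_of_le' hm
  have hdw : ∀ t ∈ Ioo (0 : ℝ) π, HasDerivAt w (deriv w t) t := fun t ht =>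
    (hd t (Ioo_subset_Icc_self ht)).hasDerivAt
  have hdw' : ∀ t ∈ Ioo (0 : ℝ) π, HasDerivAt (deriv w) (deriv (deriv w) t) t := fun t ht =>
    (hd' t ht).hasDerivAt
  obtain ⟨ξ, hξ, hξ0, hξw'⟩ := exists_seq_tendsto_deriv pi_pos
    (fun t ht => hd t (Ico_subset_Icc_self ht))
  have hξw : Filter.Tendsto (fun i => w (ξ i)) Filter.atTop (nhds 1) := by
    rw [← hw0]
    exact (hd 0 ⟨le_rfl, pi_pos.le⟩).continuousAt.tendsto.comp hξ0
  have hW : ∀ t ∈ Ioo (0 : ℝ) π, HasDerivAt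
      (fun t => Real.sin t ^ (k + 1) * (w t * u' t - deriv w t * u t)) 0 t := by
    intro t ht
    have hs : Real.sin t ≠ 0 := (Real.sin_pos_of_pos_of_lt_pi ht.1 ht.2).ne'
    refine (((Real.hasDerivAt_sin t).pow (k + 1)).mul
      (((hdw t ht).mul (hu' t)).sub ((hdw' t ht).mul (hu t)))).congr_deriv ?_
    have h1 := hode t ht
    have h2 := hwode t ht
    push_cast at h1 h2 ⊢
    simp only [Pi.pow_apply, Pi.mul_apply, Pi.sub_apply]
    field_simp at h1 h2
    rw [pow_succ]
    linear_combination Real.sin t ^ k * (w t * h1 - u t * h2)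
  have hconst {f : ℝ → ℝ} (hf : ∀ t ∈ Ioo (0 : ℝ) π, HasDerivAt f 0 t) :
      ∀ s ∈ Ioo (0 : ℝ) π, ∀ t ∈ Ioo (0 : ℝ) π, f s = f t := fun s hs t ht =>
    isOpen_Ioo.is_const_of_deriv_eq_zero isPreconnected_Ioo
      (fun t ht => (hf t ht).differentiableAt.differentiableWithinAt)
      (fun t ht => (hf t ht).deriv) hs ht
  have hwronsk : ∀ t ∈ Ioo (0 : ℝ) π, w t * u' t = deriv w t * u t := by
    intro t ht
    have hlim := ((((Real.continuous_sin.tendsto 0).comp hξ0).pow (k + 1)).mul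
      ((hξw.mul ((hu' 0).continuousAt.tendsto.comp hξ0)).sub
        (hξw'.mul ((hu 0).continuousAt.tendsto.comp hξ0))))
    rw [Real.sin_zero, zero_pow (by omega), zero_mul] at hlim
    have h0 := tendsto_nhds_unique (hlim.congr fun i => hconst hW _ (hξ i) t ht)
      tendsto_const_nhds
    have hs : Real.sin t ≠ 0 := (Real.sin_pos_of_pos_of_lt_pi ht.1 ht.2).ne'
    have := (mul_eq_zero.1 h0.symm).resolve_left (pow_ne_zero _ hs)
    exact sub_eq_zero.1 this
  have hpos : ∀ t ∈ Ioo (0 : ℝ) π, u t ^ 2 + u' t ^ 2 ≠ 0 := by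
    intro t ht h
    have h0 : u t = 0 := by nlinarith [sq_nonneg (u t), sq_nonneg (u' t)]
    have h1 : u' t = 0 := by nlinarith [sq_nonneg (u t), sq_nonneg (u' t)]
    exact hsimple t ht h0 h1
  obtain ⟨g, hg⟩ : ∃ g : ℝ → ℝ,
      g = fun t => (w t * u t + deriv w t * u' t) / (u t ^ 2 + u' t ^ 2) := ⟨_, rfl⟩
  have hgw : ∀ t ∈ Ioo (0 : ℝ) π, w t = g t * u t := by
    intro t ht
    have := hpos t ht
    simp only [hg]
    field_simp
    linear_combination u' t * hwronsk t ht
  have hgw' : ∀ t ∈ Ioo (0 : ℝ) π, deriv w t = g t * u' t := by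
    intro t ht
    have := hpos t ht
    simp only [hg]
    field_simp
    linear_combination -u t * hwronsk t ht
  have hgderiv : ∀ t ∈ Ioo (0 : ℝ) π, HasDerivAt g 0 t := by
    intro t ht
    have hgd : DifferentiableAt ℝ g t := by
      rw [hg]
      exact (((hdw t ht).differentiableAt.mul (hu t).differentiableAt).add
        ((hdw' t ht).differentiableAt.mul (hu' t).differentiableAt)).div
        (((hu t).differentiableAt.pow 2).add ((hu' t).differentiableAt.pow 2)) (hpos t ht)
    have hnhds := isOpen_Ioo.mem_nhds ht
    have e1 := (hdw t ht).unique ((hgd.hasDerivAt.mul (hu t)).congr_of_eventuallyEq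
      (Filter.eventuallyEq_of_mem hnhds hgw))
    have e2 := (hdw' t ht).unique ((hgd.hasDerivAt.mul (hu' t)).congr_of_eventuallyEq
      (Filter.eventuallyEq_of_mem hnhds hgw'))
    have h1 : deriv g t * u t = 0 := by linear_combination hgw' t ht - e1
    have h2 : deriv g t * u' t = 0 := by
      have h3 := hwode t ht
      rw [hgw t ht, hgw' t ht, e2] at h3
      linear_combination h3 - g t * hode t ht
    have h0 : deriv g t = 0 := by
      refine (mul_eq_zero.1 ?_).resolve_right (hpos t ht)
      linear_combination u t * h1 + u' t * h2
    exact h0 ▸ hgd.hasDerivAt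
  have hmul : ∀ t ∈ Ioo (0 : ℝ) π, w t = g (ξ 0) * u t := fun t ht => by
    rw [hconst hgderiv _ (hξ 0) t ht, hgw t ht]
  refine ⟨g (ξ 0), fun h => ?_, hmul⟩
  have := tendsto_nhds_unique (hξw.congr fun i => by rw [hmul _ (hξ i), h, zero_mul])
    tendsto_const_nhds
  exact one_ne_zero this

/-- For `A = n(n+m-1)`, a normalized solution of the linearized equation has
exactly `n` zeros in the interval `(0, π)`. -/
theorem linsol_card_zeros (m n : ℕ) (hm : 2 ≤ m) (w : ℝ → ℝ)
    (hw : IsNormalizedLinSolution m ((n : ℝ) * ((n : ℝ) + (m : ℝ) - 1)) w) :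
    {t ∈ Ioo (0 : ℝ) π | w t = 0}.Finite ∧
      {t ∈ Ioo (0 : ℝ) π | w t = 0}.ncard = n := by
  obtain ⟨P, -, hode, hsimple, Z, hZcard, hZ⟩ := exists_gegenbauer_solution n m (by omega)
  have hcos : ∀ t ∈ Ioo (0 : ℝ) π, Real.cos t ∈ Ioo (-1 : ℝ) 1 := by
    intro t ht
    have hs := Real.sin_pos_of_pos_of_lt_pi ht.1 ht.2
    constructor <;> nlinarith [Real.sin_sq_add_cos_sq t]
  obtain ⟨c, hc, hwc⟩ := hw.exists_eq_mul hm (u := fun t => P.eval (Real.cos t))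
    (u' := fun t => P.derivative.eval (Real.cos t) * -Real.sin t)
    (u'' := fun t => P.derivative.derivative.eval (Real.cos t) * -Real.sin t * -Real.sin t +
      P.derivative.eval (Real.cos t) * -Real.cos t)
    (fun t => (P.hasDerivAt _).comp t (Real.hasDerivAt_cos t))
    (fun t => ((P.derivative.hasDerivAt _).comp t (Real.hasDerivAt_cos t)).mul
      (Real.hasDerivAt_sin t).neg)
    (fun t ht => by
      have hs : Real.sin t ≠ 0 := (Real.sin_pos_of_pos_of_lt_pi ht.1 ht.2).ne'
      field_simp
      linear_combination hode (Real.cos t) +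
        P.derivative.derivative.eval (Real.cos t) * Real.sin_sq_add_cos_sq t)
    (fun t ht h0 => mul_ne_zero (hsimple _ (hcos t ht) h0)
      (neg_ne_zero.2 (Real.sin_pos_of_pos_of_lt_pi ht.1 ht.2).ne'))
  have hset : {t ∈ Ioo (0 : ℝ) π | w t = 0} = Real.arccos '' (Z : Set ℝ) := by
    ext t
    simp only [mem_ofPred_eq, mem_image, Finset.mem_coe, hZ]
    constructor
    · rintro ⟨ht, h0⟩
      refine ⟨Real.cos t, ⟨hcos t ht, ?_⟩, Real.arccos_cos ht.1.le ht.2.le⟩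
      rw [hwc t ht] at h0
      exact (mul_eq_zero.1 h0).resolve_left hc
    · rintro ⟨x, ⟨hx, h0⟩, rfl⟩
      have hmem : Real.arccos x ∈ Ioo (0 : ℝ) π :=
        ⟨Real.arccos_pos.2 hx.2, Real.arccos_lt_pi.2 hx.1⟩
      refine ⟨hmem, ?_⟩
      rw [hwc _ hmem, Real.cos_arccos hx.1.le hx.2.le, h0, mul_zero]
  rw [hset]
  refine ⟨Z.finite_toSet.image _, ?_⟩
  have hinj : InjOn Real.arccos (Z : Set ℝ) :=
    Real.arccos_injOn.mono fun x hx => Ioo_subset_Icc_self ((hZ x).1 hx).1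
  rw [hinj.ncard_image, ncard_coe_finset, hZcard]
end

section
/- Fix integers m ≥ 2 and n ≥ 0, and set A = n(n+m−1). If w is a normalized solution of the linearized equation with parameter A, then the sets {t ∈ (0,π/2) : w(t) = 0} and {t ∈ (π/2,π) : w(t) = 0} are finite and have the same number of elements. -/
open Real Set

namespace IsNormalizedLinSolution

variable {m : ℕ} {A : ℝ} {w : ℝ → ℝ}

lemma hasDerivAt (hw : IsNormalizedLinSolution m A w) {t : ℝ} (ht : t ∈ Icc 0 π) :
    HasDerivAt w (deriv w t) t :=
  (hw.2.1 t ht).hasDerivAt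

lemma hasDerivAt_deriv (hw : IsNormalizedLinSolution m A w) {t : ℝ} (ht : t ∈ Ioo 0 π) :
    HasDerivAt (deriv w) (-(((m : ℝ) - 1) * (cos t / sin t) * deriv w t) - A * w t) t := by
  obtain ⟨-, -, h, -, -, heq⟩ := hw
  have := (h t ht).hasDerivAt
  rwa [show deriv (deriv w) t = -(((m : ℝ) - 1) * (cos t / sin t) * deriv w t) - A * w t by
    linarith [heq t ht]] at this

/-- Backward uniqueness: vanishing Cauchy data at an interior point propagates to the left. -/
lemma eq_zero_of_cauchy_data (hw : IsNormalizedLinSolution m A w) {s t : ℝ}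
    (hs : 0 < s) (hst : s ≤ t) (ht : t < π) (h0 : w t = 0) (h1 : deriv w t = 0) : w s = 0 := by
  have hsub : ∀ x ∈ Icc s t, x ∈ Ioo 0 π := fun x hx =>
    ⟨hs.trans_le hx.1, hx.2.trans_lt ht⟩
  have hcot : ContinuousOn (fun x : ℝ => ((m : ℝ) - 1) * (cos x / sin x)) (Icc s t) :=
    continuousOn_const.mul <| continuous_cos.continuousOn.div continuous_sin.continuousOn
      fun x hx => (sin_pos_of_mem_Ioo (hsub x hx)).ne'
  obtain ⟨M, hM⟩ := isCompact_Icc.exists_bound_of_continuousOn hcot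
  set K : ℝ := 2 * |M| + |1 - A| with hK
  have hder : ∀ x ∈ Icc s t, HasDerivAt
      (fun x => exp (K * x) * (deriv w x ^ 2 + w x ^ 2))
      (exp (K * x) * (K * (deriv w x ^ 2 + w x ^ 2)
        - 2 * (((m : ℝ) - 1) * (cos x / sin x)) * deriv w x ^ 2
        + 2 * (1 - A) * (w x * deriv w x))) x := by
    intro x hx
    have hx' := hsub x hx
    have hD := hw.hasDerivAt_deriv hx'
    have hW := hw.hasDerivAt (Ioo_subset_Icc_self hx')
    have hE : HasDerivAt (fun x : ℝ => exp (K * x)) (exp (K * x) * (K * 1)) x :=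
      ((hasDerivAt_id x).const_mul K).exp
    refine (hE.mul ((hD.pow 2).add (hW.pow 2))).congr_deriv ?_
    simp only [Pi.add_apply, Pi.pow_apply]
    push_cast
    ring
  have hmono : MonotoneOn (fun x => exp (K * x) * (deriv w x ^ 2 + w x ^ 2)) (Icc s t) := by
    refine monotoneOn_of_hasDerivWithinAt_nonneg (convex_Icc s t)
      (fun x hx => (hder x hx).continuousAt.continuousWithinAt)
      (fun x hx => (hder x (interior_subset hx)).hasDerivWithinAt) fun x hx => ?_
    have hb := hM x (interior_subset hx)
    rw [Real.norm_eq_abs] at hb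
    have hb1 := (le_abs_self (((m : ℝ) - 1) * (cos x / sin x))).trans (hb.trans (le_abs_self M))
    refine mul_nonneg (exp_pos _).le ?_
    have e1 : 0 ≤ (|M| - ((m : ℝ) - 1) * (cos x / sin x)) * deriv w x ^ 2 :=
      mul_nonneg (by linarith) (sq_nonneg _)
    have e2 : 0 ≤ |M| * w x ^ 2 := by positivity
    have e3 : -(|1 - A| * (deriv w x ^ 2 + w x ^ 2)) ≤ 2 * (1 - A) * (w x * deriv w x) := by
      have e4 : |2 * (1 - A) * (w x * deriv w x)| ≤ |1 - A| * (deriv w x ^ 2 + w x ^ 2) := by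
        rw [show 2 * (1 - A) * (w x * deriv w x) = (1 - A) * (2 * (w x * deriv w x)) by ring,
          abs_mul]
        refine mul_le_mul_of_nonneg_left (abs_le.2 ⟨?_, ?_⟩) (abs_nonneg _)
        · nlinarith [sq_nonneg (w x + deriv w x)]
        · nlinarith [sq_nonneg (w x - deriv w x)]
      exact neg_le_of_abs_le e4
    rw [hK]
    linarith
  have h := hmono (left_mem_Icc.2 hst) (right_mem_Icc.2 hst) hst
  simp only [h0, h1] at h
  have h' : deriv w s ^ 2 + w s ^ 2 ≤ 0 := by
    by_contra! hlt
    have := mul_pos (exp_pos (K * s)) hlt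
    linarith
  exact pow_eq_zero_iff two_ne_zero |>.1 (by linarith [sq_nonneg (deriv w s), sq_nonneg (w s)])

lemma deriv_ne_zero_of_eq_zero (hw : IsNormalizedLinSolution m A w) {t : ℝ} (ht : t ∈ Ioo 0 π)
    (h0 : w t = 0) : deriv w t ≠ 0 := by
  intro h1
  have hc : Filter.Tendsto w (nhdsWithin 0 (Ioi 0)) (nhds (w 0)) :=
    (hw.hasDerivAt (left_mem_Icc.2 pi_pos.le)).continuousAt.tendsto.mono_left nhdsWithin_le_nhds
  have hz : w =ᶠ[nhdsWithin 0 (Ioi 0)] fun _ => 0 := by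
    filter_upwards [Ioo_mem_nhdsGT ht.1] with s hs
    exact hw.eq_zero_of_cauchy_data hs.1 hs.2.le ht.2 h0 h1
  have h := tendsto_nhds_unique (hc.congr' hz) tendsto_const_nhds
  rw [hw.2.2.2.1] at h
  exact one_ne_zero h

/-- Up to sign, the weighted Wronskian of `w` and its reflection `t ↦ w (π - t)`. -/
lemma weighted_wronskian_reflection_const (hm : 2 ≤ m) (hw : IsNormalizedLinSolution m A w) :
    ∃ C, ∀ t ∈ Ioo (0 : ℝ) π,
      sin t ^ (m - 1) * (w t * deriv w (π - t) + w (π - t) * deriv w t) = C := by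
  obtain ⟨k, rfl⟩ := Nat.exists_eq_add_of_le' hm
  have hder : ∀ t ∈ Ioo (0 : ℝ) π, HasDerivAt (fun t => sin t ^ (k + 2 - 1) *
      (w t * deriv w (π - t) + w (π - t) * deriv w t)) 0 t := by
    intro t ht
    have ht' : π - t ∈ Ioo (0 : ℝ) π := ⟨by linarith [ht.2], by linarith [ht.1]⟩
    have hr : HasDerivAt (fun t : ℝ => π - t) (-1) t := (hasDerivAt_id t).const_sub π
    have hD := hw.hasDerivAt_deriv ht
    have hW := hw.hasDerivAt (Ioo_subset_Icc_self ht)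
    have hD' := (hw.hasDerivAt_deriv ht').comp t hr
    have hW' := (hw.hasDerivAt (Ioo_subset_Icc_self ht')).comp t hr
    have hS := (hasDerivAt_sin t).pow (k + 2 - 1)
    have hs : sin t ≠ 0 := (sin_pos_of_mem_Ioo ht).ne'
    refine (hS.mul ((hW.mul hD').add (hW'.mul hD))).congr_deriv ?_
    simp only [Function.comp_apply, Pi.add_apply, Pi.mul_apply, Pi.pow_apply, cos_pi_sub,
      sin_pi_sub, show k + 2 - 1 = k + 1 from rfl, Nat.add_sub_cancel]
    push_cast
    field_simp
    ring
  exact isOpen_Ioo.exists_is_const_of_deriv_eq_zero isPreconnected_Ioo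
    (fun x hx => (hder x hx).differentiableAt.differentiableWithinAt)
    (fun x hx => (hder x hx).deriv)

lemma wronskian_reflection_eq_zero (hm : 2 ≤ m) (hw : IsNormalizedLinSolution m A w) {t : ℝ}
    (ht : t ∈ Ioo 0 π) : w t * deriv w (π - t) + w (π - t) * deriv w t = 0 := by
  obtain ⟨C, hC⟩ := hw.weighted_wronskian_reflection_const hm
  have hder0 := hw.hasDerivAt (left_mem_Icc.2 pi_pos.le)
  have hw0 : w 0 = 1 := hw.2.2.2.1
  have hrefl : ∀ x ∈ Icc (0 : ℝ) π, HasDerivAt (fun t => w (π - t)) (-deriv w (π - x)) x := by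
    intro x hx
    have hr : HasDerivAt (fun t : ℝ => π - t) (-1) x := (hasDerivAt_id x).const_sub π
    have hx' : π - x ∈ Icc (0 : ℝ) π := ⟨by linarith [hx.2], by linarith [hx.1]⟩
    exact ((hw.hasDerivAt hx').comp x hr).congr_deriv (by ring)
  have hquot : ∀ x ∈ Icc (0 : ℝ) π, w x ≠ 0 → HasDerivAt (fun t => w (π - t) / w t)
      (-(w x * deriv w (π - x) + w (π - x) * deriv w x) / w x ^ 2) x := fun x hx hx0 =>
    ((hrefl x hx).div (hw.hasDerivAt hx) hx0).congr_deriv (by ring)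
  obtain ⟨δ, hδ, hball⟩ := Metric.eventually_nhds_iff.1
    (hder0.continuousAt.eventually_ne (hw0.trans_ne one_ne_zero))
  have hmvt : ∀ t, ∃ c, t ∈ Ioo 0 (min δ π) → c ∈ Ioo 0 t ∧
      slope (fun t => w (π - t) / w t) 0 t * (sin c ^ (m - 1) * w c ^ 2) = -C := by
    intro t
    by_cases ht : t ∈ Ioo 0 (min δ π)
    swap
    · exact ⟨0, fun h => absurd h ht⟩
    have htδ := ht.2.trans_le (min_le_left _ _)
    have htπ := ht.2.trans_le (min_le_right _ _)
    have hne : ∀ x ∈ Icc 0 t, w x ≠ 0 := fun x hx => hball <| by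
      rw [Real.dist_eq, sub_zero, abs_of_nonneg hx.1]
      exact hx.2.trans_lt htδ
    have hIcc : ∀ x ∈ Icc 0 t, x ∈ Icc 0 π := fun x hx => ⟨hx.1, hx.2.trans htπ.le⟩
    obtain ⟨c, hc, hceq⟩ := exists_hasDerivAt_eq_slope (fun t => w (π - t) / w t) _ ht.1
      (fun x hx => (hquot x (hIcc x hx) (hne x hx)).continuousAt.continuousWithinAt)
      (fun x hx => hquot x (hIcc x (Ioo_subset_Icc_self hx)) (hne x (Ioo_subset_Icc_self hx)))
    refine ⟨c, fun _ => ⟨hc, ?_⟩⟩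
    have hwc := hne c (Ioo_subset_Icc_self hc)
    rw [slope_def_field, ← hceq, ← hC c ⟨hc.1, hc.2.trans htπ⟩]
    field_simp
  choose c hc using hmvt
  have hev : ∀ᶠ t in nhdsWithin (0 : ℝ) (Ioi 0), t ∈ Ioo 0 (min δ π) :=
    Ioo_mem_nhdsGT (lt_min hδ pi_pos)
  have hc0 : Filter.Tendsto c (nhdsWithin 0 (Ioi 0)) (nhds 0) := by
    refine tendsto_of_tendsto_of_tendsto_of_le_of_le' tendsto_const_nhds
      (Filter.tendsto_id.mono_left nhdsWithin_le_nhds) ?_ ?_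
    · filter_upwards [hev] with t ht using (hc t ht).1.1.le
    · filter_upwards [hev] with t ht using (hc t ht).1.2.le
  have hslope := (hasDerivAt_iff_tendsto_slope.1
    (hquot 0 (left_mem_Icc.2 pi_pos.le) (hw0.trans_ne one_ne_zero))).mono_left
    (nhdsWithin_mono (s := Ioi 0) 0 fun _ hx => (mem_Ioi.1 hx).ne')
  have hprod := hslope.mul
    (((continuous_sin.continuousAt.tendsto.comp hc0).pow (m - 1)).mul
      ((hder0.continuousAt.tendsto.comp hc0).pow 2))
  have hlim := tendsto_nhds_unique (hprod.congr' (by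
    filter_upwards [hev] with t ht using (hc t ht).2)) tendsto_const_nhds
  have hC0 : C = 0 := by
    rw [sin_zero, zero_pow (by omega)] at hlim
    linarith
  have h := hC t ht
  rw [hC0] at h
  exact (mul_eq_zero.1 h).resolve_left (pow_ne_zero _ (sin_pos_of_mem_Ioo ht).ne')

lemma reflection_eq_zero (hm : 2 ≤ m) (hw : IsNormalizedLinSolution m A w) {t : ℝ}
    (ht : t ∈ Ioo 0 π) (h0 : w t = 0) : w (π - t) = 0 := by
  have h := hw.wronskian_reflection_eq_zero hm ht
  rw [h0, zero_mul, zero_add] at h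
  exact (mul_eq_zero.1 h).resolve_right (hw.deriv_ne_zero_of_eq_zero ht h0)

lemma finite_zeros_of_lt_pi (hw : IsNormalizedLinSolution m A w) {b : ℝ} (hb : b < π) :
    {t ∈ Ioo 0 b | w t = 0}.Finite := by
  by_contra hinf
  obtain ⟨x, hx, hacc⟩ := Set.Infinite.exists_accPt_of_subset_isCompact hinf
    (isCompact_Icc (a := (0 : ℝ)) (b := b)) fun t ht => Ioo_subset_Icc_self ht.1
  have hfreq := accPt_iff_frequently_nhdsNE.1 hacc
  have hx' : x ∈ Icc 0 π := ⟨hx.1, hx.2.trans hb.le⟩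
  have hne : ∀ᶠ y in nhdsWithin x {x}ᶜ, w y ≠ 0 := by
    by_cases hwx : w x = 0
    · have hx0 : x ≠ 0 := by
        rintro rfl
        exact one_ne_zero (hw.2.2.2.1.symm.trans hwx)
      exact (hw.hasDerivAt hx').eventually_ne
        (hw.deriv_ne_zero_of_eq_zero ⟨hx.1.lt_of_ne' hx0, hx.2.trans_lt hb⟩ hwx)
    · exact ((hw.hasDerivAt hx').continuousAt.eventually_ne hwx).filter_mono nhdsWithin_le_nhds
  exact hfreq (hne.mono fun y hy hy' => hy hy'.2)

end IsNormalizedLinSolution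

/-- For `A = n(n+m-1)`, a normalized solution of the linearized equation has
as many zeros in `(0, π/2)` as in `(π/2, π)`. -/
theorem linsol_zeros_balanced (m n : ℕ) (hm : 2 ≤ m) (w : ℝ → ℝ)
    (hw : IsNormalizedLinSolution m ((n : ℝ) * ((n : ℝ) + (m : ℝ) - 1)) w) :
    {t ∈ Ioo (0 : ℝ) (π / 2) | w t = 0}.Finite ∧
    {t ∈ Ioo (π / 2) π | w t = 0}.Finite ∧
    {t ∈ Ioo (0 : ℝ) (π / 2) | w t = 0}.ncard
      = {t ∈ Ioo (π / 2) π | w t = 0}.ncard := by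
  have hπ := pi_pos
  have himage : {t ∈ Ioo (π / 2) π | w t = 0}
      = (fun t => π - t) '' {t ∈ Ioo (0 : ℝ) (π / 2) | w t = 0} := by
    ext t
    constructor
    · rintro ⟨⟨h1, h2⟩, h0⟩
      exact ⟨π - t, ⟨⟨by linarith, by linarith⟩,
        hw.reflection_eq_zero hm ⟨by linarith, h2⟩ h0⟩, by simp⟩
    · rintro ⟨s, ⟨⟨h1, h2⟩, h0⟩, rfl⟩
      exact ⟨⟨by simp only; linarith, by simp only; linarith⟩,
        hw.reflection_eq_zero hm ⟨h1, by linarith⟩ h0⟩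
  have hfin := hw.finite_zeros_of_lt_pi (half_lt_self hπ)
  refine ⟨hfin, ?_, ?_⟩
  · rw [himage]
    exact hfin.image _
  · rw [himage, ncard_image_of_injective _ sub_right_injective]
end

section
/- Fix an integer m ≥ 2 and real numbers 0 < A < B. Let w_A be a normalized solution of the linearized equation with parameter A and w_B a normalized solution of the linearized equation with parameter B. If t₁, t₂ ∈ (0,π) with t₁ < t₂ and w_A(t₁) = w_A(t₂) = 0, then there exists s ∈ (t₁,t₂) with w_B(s) = 0. -/
open Real Set

/-- `u` solves `u'' + n (cos t / sin t) u' + A u = 0` on `(0, π)`, with derivative `u'`. -/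
def IsLinSolution (n : ℕ) (A : ℝ) (u u' : ℝ → ℝ) : Prop :=
  ∀ t ∈ Ioo (0 : ℝ) π, HasDerivAt u (u' t) t ∧
    HasDerivAt u' (-(n * (cos t / sin t) * u' t + A * u t)) t

theorem IsLinSolution.neg {n : ℕ} {A : ℝ} {u u' : ℝ → ℝ} (h : IsLinSolution n A u u') :
    IsLinSolution n A (-u) (-u') := fun t ht =>
  ⟨(h t ht).1.neg, (h t ht).2.neg.congr_deriv (by simp only [Pi.neg_apply]; ring)⟩

theorem IsNormalizedLinSolution.isLinSolution {m : ℕ} (hm : 1 ≤ m) {A : ℝ} {w : ℝ → ℝ}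
    (h : IsNormalizedLinSolution m A w) : IsLinSolution (m - 1) A w (deriv w) := by
  obtain ⟨-, h1, h2, -, -, h3⟩ := h
  intro t ht
  refine ⟨(h1 t (Ioo_subset_Icc_self ht)).hasDerivAt, (h2 t ht).hasDerivAt.congr_deriv ?_⟩
  push_cast [hm]
  linarith [h3 t ht]

theorem hasDerivAt_sin_pow (n : ℕ) {t : ℝ} (ht : sin t ≠ 0) :
    HasDerivAt (fun t => sin t ^ n) (n * (cos t / sin t) * sin t ^ n) t := by
  refine ((hasDerivAt_sin t).pow n).congr_deriv ?_
  rcases n with _ | k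
  · simp
  · simp only [Nat.add_sub_cancel]
    field_simp
    ring

/-- The derivative is nonnegative at a left endpoint zero of a function positive to its right. -/
theorem HasDerivAt.nonneg_of_pos_right {u : ℝ → ℝ} {d a b : ℝ} (hab : a < b)
    (hd : HasDerivAt u d a) (h0 : u a = 0) (hpos : ∀ t ∈ Ioo a b, 0 < u t) : 0 ≤ d := by
  have h := hasDerivWithinAt_iff_tendsto_slope' (s := Ioi a) (by simp) |>.1
    hd.hasDerivWithinAt
  refine ge_of_tendsto h ?_
  filter_upwards [Ioo_mem_nhdsGT hab] with t ht
  rw [slope_def_field, h0, sub_zero]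
  exact (div_pos (hpos t ht) (sub_pos.2 ht.1)).le

/-- The derivative is nonpositive at a right endpoint zero of a function positive to its left. -/
theorem HasDerivAt.nonpos_of_pos_left {u : ℝ → ℝ} {d a b : ℝ} (hab : a < b)
    (hd : HasDerivAt u d b) (h0 : u b = 0) (hpos : ∀ t ∈ Ioo a b, 0 < u t) : d ≤ 0 := by
  have h := hasDerivWithinAt_iff_tendsto_slope' (s := Iio b) (by simp) |>.1
    hd.hasDerivWithinAt
  refine le_of_tendsto h ?_
  filter_upwards [Ioo_mem_nhdsLT hab] with t ht
  rw [slope_def_field, h0, sub_zero]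
  exact (div_neg_of_pos_of_neg (hpos t ht) (sub_neg.2 ht.2)).le

/-- Sturm comparison: two solutions with parameters `A < B` cannot both be positive between two
zeros of the solution with parameter `A`. -/
theorem IsLinSolution.not_both_pos {n : ℕ} {A B : ℝ} (hAB : A < B) {u u' v v' : ℝ → ℝ}
    (hu : IsLinSolution n A u u') (hv : IsLinSolution n B v v') {a b : ℝ} (ha : 0 < a)
    (hb : b < π) (hab : a < b) (hua : u a = 0) (hub : u b = 0)
    (hupos : ∀ t ∈ Ioo a b, 0 < u t) (hvpos : ∀ t ∈ Ioo a b, 0 < v t) : False := by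
  have hsub : Icc a b ⊆ Ioo 0 π := fun t ht => ⟨ha.trans_le ht.1, ht.2.trans_lt hb⟩
  have hW : ∀ t ∈ Icc a b, HasDerivAt (fun t => sin t ^ n * (u' t * v t - u t * v' t))
      ((B - A) * (sin t ^ n * (u t * v t))) t := by
    intro t ht
    obtain ⟨hu1, hu2⟩ := hu t (hsub ht)
    obtain ⟨hv1, hv2⟩ := hv t (hsub ht)
    refine ((hasDerivAt_sin_pow n (sin_pos_of_mem_Ioo (hsub ht)).ne').mul
      ((hu2.mul hv1).sub (hu1.mul hv2))).congr_deriv ?_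
    simp only [Pi.sub_apply, Pi.mul_apply]
    ring
  have hmono := strictMonoOn_of_deriv_pos (convex_Icc a b)
    (fun t ht => (hW t ht).continuousAt.continuousWithinAt) (fun t ht => by
      rw [interior_Icc] at ht
      have ht' := Ioo_subset_Icc_self ht
      rw [(hW t ht').deriv]
      have := sin_pos_of_mem_Ioo (hsub ht')
      have := hupos t ht
      have := hvpos t ht
      have := sub_pos.2 hAB
      positivity)
  have hlt := hmono (left_mem_Icc.2 hab.le) (right_mem_Icc.2 hab.le) hab
  simp only [hua, hub, zero_mul, sub_zero] at hlt
  have hva : ∀ t ∈ Icc a b, 0 ≤ v t := by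
    rw [← closure_Ioo hab.ne]
    refine fun t ht => le_on_closure (f := fun _ => (0 : ℝ)) (fun x hx => (hvpos x hx).le)
      continuousOn_const ?_ ht
    rw [closure_Ioo hab.ne]
    exact fun x hx => (hv x (hsub hx)).1.continuousAt.continuousWithinAt
  have haI := left_mem_Icc.2 hab.le
  have hbI := right_mem_Icc.2 hab.le
  have h1 : 0 ≤ sin a ^ n * (u' a * v a) :=
    mul_nonneg (pow_nonneg (sin_pos_of_mem_Ioo (hsub haI)).le n) (mul_nonneg
      ((hu a (hsub haI)).1.nonneg_of_pos_right hab hua hupos) (hva a haI))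
  have h2 : sin b ^ n * (u' b * v b) ≤ 0 :=
    mul_nonpos_of_nonneg_of_nonpos (pow_nonneg (sin_pos_of_mem_Ioo (hsub hbI)).le n)
      (mul_nonpos_of_nonpos_of_nonneg
        ((hu b (hsub hbI)).1.nonpos_of_pos_left hab hub hupos) (hva b hbI))
  linarith

theorem pos_or_neg_of_ne_zero_on_Ioo {u : ℝ → ℝ} {a b : ℝ} (hu : ContinuousOn u (Ioo a b))
    (h0 : ∀ t ∈ Ioo a b, u t ≠ 0) :
    (∀ t ∈ Ioo a b, 0 < u t) ∨ (∀ t ∈ Ioo a b, 0 < (-u) t) := by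
  by_contra! h
  obtain ⟨⟨x, hx, hux⟩, y, hy, huy⟩ := h
  obtain ⟨z, hz, hz0⟩ := isPreconnected_Ioo.intermediate_value hx hy hu
    ⟨hux, by simpa using huy⟩
  exact h0 z hz hz0

/-- Zeros nearest to a point where `u` does not vanish. -/
theorem exists_adjacent_zeros {u : ℝ → ℝ} {t₁ t₂ c : ℝ} (hu : ContinuousOn u (Icc t₁ t₂))
    (hc : c ∈ Icc t₁ t₂) (huc : u c ≠ 0) (h1 : u t₁ = 0) (h2 : u t₂ = 0) :
    ∃ a b, t₁ ≤ a ∧ a < b ∧ b ≤ t₂ ∧ u a = 0 ∧ u b = 0 ∧ ∀ t ∈ Ioo a b, u t ≠ 0 := by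
  have hk1 : IsCompact (Icc t₁ c ∩ u ⁻¹' {0}) :=
    isCompact_Icc.of_isClosed_subset
      ((hu.mono (Icc_subset_Icc_right hc.2)).preimage_isClosed_of_isClosed
        isClosed_Icc isClosed_singleton) inter_subset_left
  have hk2 : IsCompact (Icc c t₂ ∩ u ⁻¹' {0}) :=
    isCompact_Icc.of_isClosed_subset
      ((hu.mono (Icc_subset_Icc_left hc.1)).preimage_isClosed_of_isClosed
        isClosed_Icc isClosed_singleton) inter_subset_left
  obtain ⟨a, ⟨ha, hua⟩, hamax⟩ := hk1.exists_isGreatest ⟨t₁, left_mem_Icc.2 hc.1, h1⟩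
  obtain ⟨b, ⟨hb, hub⟩, hbmin⟩ := hk2.exists_isLeast ⟨t₂, right_mem_Icc.2 hc.2, h2⟩
  have hac : a < c := ha.2.lt_of_ne (by rintro rfl; exact huc hua)
  have hcb : c < b := hb.1.lt_of_ne (by rintro rfl; exact huc hub)
  refine ⟨a, b, ha.1, hac.trans hcb, hb.2, hua, hub, fun t ht ht0 => ?_⟩
  rcases le_total t c with htc | htc
  · exact ht.1.not_ge (hamax ⟨⟨ha.1.trans ht.1.le, htc⟩, ht0⟩)
  · exact ht.2.not_ge (hbmin ⟨⟨htc, ht.2.le.trans hb.2⟩, ht0⟩)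

/-- A solution with vanishing Cauchy data at `c` vanishes to the left of `c`. -/
theorem IsLinSolution.eq_zero_left {n : ℕ} {A : ℝ} (hA : 0 < A) {u u' : ℝ → ℝ}
    (hu : IsLinSolution n A u u') {c : ℝ} (hc : c ∈ Ioo 0 π) (h0 : u c = 0) (h0' : u' c = 0) :
    ∀ t ∈ Ioc 0 (min c (π / 2)), u t = 0 := by
  have hE : ∀ t ∈ Ioo (0 : ℝ) π, HasDerivAt (fun t => u' t ^ 2 + A * u t ^ 2)
      (-(2 * n * (cos t / sin t) * u' t ^ 2)) t := fun t ht => by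
    refine (((hu t ht).2.pow 2).add (((hu t ht).1.pow 2).const_mul A)).congr_deriv ?_
    norm_num
    ring
  have hF : ∀ t ∈ Ioo (0 : ℝ) π, HasDerivAt
      (fun t => sin t ^ (2 * n) * (u' t ^ 2 + A * u t ^ 2))
      (sin t ^ (2 * n) * (2 * n * (cos t / sin t) * (A * u t ^ 2))) t := fun t ht => by
    refine ((hasDerivAt_sin_pow (2 * n) (sin_pos_of_mem_Ioo ht).ne').mul (hE t ht)).congr_deriv ?_
    push_cast
    ring
  set d := min c (π / 2) with hd
  have hd0 : 0 < d := lt_min hc.1 (by positivity)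
  have hdπ : d ≤ π / 2 := min_le_right _ _
  have hEd : u' d ^ 2 + A * u d ^ 2 = 0 := by
    rcases le_total c (π / 2) with h | h
    · rw [hd, min_eq_left h, h0, h0']; simp
    · rw [hd, min_eq_right h]
      have hsub : Icc (π / 2) c ⊆ Ioo 0 π := fun t ht =>
        ⟨by linarith [ht.1, pi_pos], ht.2.trans_lt hc.2⟩
      have hmono := monotoneOn_of_deriv_nonneg (convex_Icc (π / 2) c)
        (fun t ht => (hE t (hsub ht)).continuousAt.continuousWithinAt)
        (fun t ht => (hE t (hsub (interior_subset ht))).differentiableAt.differentiableWithinAt)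
        (fun t ht => by
          have ht := interior_subset ht
          rw [(hE t (hsub ht)).deriv]
          have hcos : cos t / sin t ≤ 0 := div_nonpos_of_nonpos_of_nonneg
            (cos_nonpos_of_pi_div_two_le_of_le ht.1 (by linarith [(hsub ht).2, pi_pos]))
            (sin_pos_of_mem_Ioo (hsub ht)).le
          have : 0 ≤ 2 * n * -(cos t / sin t) * u' t ^ 2 := by
            have := neg_nonneg.2 hcos
            positivity
          linarith)
      have hle := hmono (left_mem_Icc.2 h) (right_mem_Icc.2 h) h
      simp only [h0, h0'] at hle
      refine le_antisymm (hle.trans (by simp)) (by positivity)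
  have hsub : Ioc 0 d ⊆ Ioo 0 π := fun t ht => ⟨ht.1, by linarith [ht.2, pi_pos]⟩
  have hmono := monotoneOn_of_deriv_nonneg (convex_Ioc 0 d)
    (fun t ht => (hF t (hsub ht)).continuousAt.continuousWithinAt)
    (fun t ht => (hF t (hsub (interior_subset ht))).differentiableAt.differentiableWithinAt)
    (fun t ht => by
      have ht := interior_subset ht
      rw [(hF t (hsub ht)).deriv]
      have hsin := sin_pos_of_mem_Ioo (hsub ht)
      have hcos : 0 ≤ cos t := cos_nonneg_of_neg_pi_div_two_le_of_le
        (by linarith [ht.1, pi_pos]) (ht.2.trans hdπ)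
      positivity)
  intro t ht
  have hle := hmono ht (right_mem_Ioc.2 hd0) ht.2
  simp only [hEd, mul_zero] at hle
  have hp : 0 < sin t ^ (2 * n) := pow_pos (sin_pos_of_mem_Ioo (hsub ht)) _
  have h : u' t ^ 2 + A * u t ^ 2 ≤ 0 := nonpos_of_mul_nonpos_right hle hp
  have h2 : A * u t ^ 2 ≤ 0 := by linarith [sq_nonneg (u' t)]
  exact pow_eq_zero_iff two_ne_zero |>.1 (le_antisymm (nonpos_of_mul_nonpos_right h2 hA)
    (sq_nonneg _))

/-- A normalized solution with positive parameter does not vanish identically on an interval. -/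
theorem IsNormalizedLinSolution.exists_ne_zero {m : ℕ} (hm : 1 ≤ m) {A : ℝ} (hA : 0 < A)
    {w : ℝ → ℝ} (h : IsNormalizedLinSolution m A w) {a b : ℝ} (ha : 0 < a) (hb : b < π)
    (hab : a < b) : ∃ c ∈ Ioo a b, w c ≠ 0 := by
  by_contra! hz
  obtain ⟨c, hc⟩ := nonempty_Ioo.2 hab
  have hcπ : c ∈ Ioo 0 π := ⟨ha.trans hc.1, hc.2.trans hb⟩
  have hev : w =ᶠ[nhds c] fun _ => 0 := by
    filter_upwards [Ioo_mem_nhds hc.1 hc.2] with t ht using hz t ht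
  have hzero := (h.isLinSolution hm).eq_zero_left hA hcπ (hz c hc) (by simp [hev.deriv_eq])
  have hmin : 0 < min c (π / 2) := lt_min hcπ.1 (by positivity)
  have hcont := (h.2.1 0 (left_mem_Icc.2 pi_pos.le)).continuousAt.tendsto.mono_left
    (nhdsWithin_le_nhds (s := Ioi 0))
  have hlim : Filter.Tendsto w (nhdsWithin 0 (Ioi 0)) (nhds 0) :=
    tendsto_const_nhds.congr' (by
      filter_upwards [Ioc_mem_nhdsGT hmin] with t ht using (hzero t ht).symm)
  have := tendsto_nhds_unique hcont hlim
  rw [h.2.2.2.1] at this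
  exact one_ne_zero this

/-- For `0 < A < B`, between any two zeros in `(0, π)` of a normalized
solution of the linearized equation with parameter `A` there is a zero of a
normalized solution with parameter `B`. -/
theorem linsol_zero_between (m : ℕ) (hm : 2 ≤ m) (A B : ℝ)
    (hA : 0 < A) (hAB : A < B) (wA wB : ℝ → ℝ)
    (hwA : IsNormalizedLinSolution m A wA)
    (hwB : IsNormalizedLinSolution m B wB)
    (t₁ t₂ : ℝ) (ht₁ : t₁ ∈ Ioo (0 : ℝ) π) (ht₂ : t₂ ∈ Ioo (0 : ℝ) π)
    (h12 : t₁ < t₂) (hz₁ : wA t₁ = 0) (hz₂ : wA t₂ = 0) :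
    ∃ s ∈ Ioo t₁ t₂, wB s = 0 := by
  have hm1 : 1 ≤ m := by lia
  by_contra! hne
  obtain ⟨c, hc, hwc⟩ := hwA.exists_ne_zero hm1 hA ht₁.1 ht₂.2 h12
  obtain ⟨a, b, h1a, hab, hb2, hwa, hwb, hadj⟩ := exists_adjacent_zeros
    (hwA.1.mono (Icc_subset_Icc ht₁.1.le ht₂.2.le)) (Ioo_subset_Icc_self hc) hwc hz₁ hz₂
  have ha0 : 0 < a := ht₁.1.trans_le h1a
  have hbπ : b < π := hb2.trans_lt ht₂.2
  have hsub : Ioo a b ⊆ Icc 0 π := fun t ht => ⟨(ha0.trans ht.1).le, (ht.2.trans hbπ).le⟩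
  have hu := hwA.isLinSolution hm1
  have hv := hwB.isLinSolution hm1
  have hna : (-wA) a = 0 := by simp [hwa]
  have hnb : (-wA) b = 0 := by simp [hwb]
  rcases pos_or_neg_of_ne_zero_on_Ioo (hwA.1.mono hsub) hadj with hp | hp <;>
    rcases pos_or_neg_of_ne_zero_on_Ioo (hwB.1.mono hsub)
      (fun t ht => hne t (Ioo_subset_Ioo h1a hb2 ht)) with hq | hq
  · exact hu.not_both_pos hAB hv ha0 hbπ hab hwa hwb hp hq
  · exact hu.not_both_pos hAB hv.neg ha0 hbπ hab hwa hwb hp hq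
  · exact hu.neg.not_both_pos hAB hv ha0 hbπ hab hna hnb hp hq
  · exact hu.neg.not_both_pos hAB hv.neg ha0 hbπ hab hna hnb hp hq
end

section
/- Fix an integer m ≥ 2 and real numbers 0 < A ≤ B. Let w_A be a normalized solution of the linearized equation with parameter A and w_B a normalized solution of the linearized equation with parameter B. Then the sets {t ∈ (0,π/2) : w_A'(t) = 0} and {t ∈ (0,π/2) : w_B'(t) = 0} are finite, and the first has at most as many elements as the second. -/
open Real Set

/-- First order form `w' = p / sinⁿ`, `p' = -A sinⁿ w` of the linearized equation on `[0, π/2]`,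
with `p 0 = 0` and `w 0 ≠ 0`. -/
structure IsLinSystem (n : ℕ) (A : ℝ) (w p : ℝ → ℝ) : Prop where
  cont_w : ContinuousOn w (Icc 0 (π / 2))
  cont_p : ContinuousOn p (Icc 0 (π / 2))
  deriv_w : ∀ t ∈ Ioc 0 (π / 2), HasDerivAt w (p t / sin t ^ n) t
  deriv_p : ∀ t ∈ Ioc 0 (π / 2), HasDerivAt p (-A * sin t ^ n * w t) t
  p_zero : p 0 = 0
  w_zero : w 0 ≠ 0

theorem sin_pos_of_mem_Ioc {t : ℝ} (ht : t ∈ Ioc 0 (π / 2)) : 0 < sin t :=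
  sin_pos_of_pos_of_lt_pi ht.1 (by linarith [ht.2, pi_pos])

theorem pos_or_neg_of_continuousOn {f : ℝ → ℝ} {s : Set ℝ} (hs : IsPreconnected s)
    (hf : ContinuousOn f s) (h0 : ∀ t ∈ s, f t ≠ 0) :
    (∀ t ∈ s, 0 < f t) ∨ (∀ t ∈ s, f t < 0) := by
  by_contra! h
  obtain ⟨⟨x, hx, hfx⟩, y, hy, hfy⟩ := h
  obtain ⟨z, hz, hz0⟩ := hs.intermediate_value hx hy hf ⟨hfx, hfy⟩
  exact h0 z hz hz0

namespace IsLinSystem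

variable {n : ℕ} {A B : ℝ} {w p : ℝ → ℝ}

theorem neg (h : IsLinSystem n A w p) : IsLinSystem n A (-w) (-p) where
  cont_w := h.cont_w.neg
  cont_p := h.cont_p.neg
  deriv_w t ht := (h.deriv_w t ht).neg.congr_deriv (by simp [neg_div])
  deriv_p t ht := (h.deriv_p t ht).neg.congr_deriv (by simp)
  p_zero := by simp [h.p_zero]
  w_zero := by simpa using h.w_zero

theorem w_ne_zero (h : IsLinSystem n A w p) (hA : 0 < A) {t : ℝ}
    (ht : t ∈ Icc 0 (π / 2)) (hp : p t = 0) : w t ≠ 0 := by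
  rcases ht.1.eq_or_lt with rfl | ht0
  · exact h.w_zero
  intro hw
  let F : ℝ → ℝ := fun s => p s ^ 2 + A * (sin s ^ n * w s) ^ 2
  have hF : ∀ s ∈ Ioc 0 (π / 2),
      HasDerivAt F (2 * A * n * sin s ^ n * sin s ^ (n - 1) * cos s * w s ^ 2) s := by
    intro s hs
    have h1 := (h.deriv_p s hs).pow 2
    have h2 := ((((hasDerivAt_sin s).pow n).mul (h.deriv_w s hs)).pow 2).const_mul A
    refine (h1.add h2).congr_deriv ?_
    have := (sin_pos_of_mem_Ioc hs).ne'
    simp only [Pi.mul_apply, Pi.pow_apply]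
    field_simp
    push_cast
    ring
  have hmono : MonotoneOn F (Ioc 0 (π / 2)) := by
    refine monotoneOn_of_deriv_nonneg (convex_Ioc _ _)
      (fun s hs => (hF s hs).continuousAt.continuousWithinAt)
      (fun s hs => (hF s (interior_subset hs)).differentiableAt.differentiableWithinAt) ?_
    intro s hs
    have hs := interior_subset hs
    rw [(hF s hs).deriv]
    have h1 := sin_pos_of_mem_Ioc hs
    have h2 : 0 ≤ cos s := cos_nonneg_of_neg_pi_div_two_le_of_le (by linarith [hs.1, pi_pos]) hs.2
    positivity
  have hzero : ∀ s ∈ Ioo 0 t, w s = 0 := by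
    intro s hs
    have hs' : s ∈ Ioc 0 (π / 2) := ⟨hs.1, hs.2.le.trans ht.2⟩
    have h1 : F s ≤ F t := hmono hs' ⟨ht0, ht.2⟩ hs.2.le
    have h2 : F t = 0 := by simp [F, hp, hw]
    have h3 : A * (sin s ^ n * w s) ^ 2 ≤ 0 := by
      have : F s = p s ^ 2 + A * (sin s ^ n * w s) ^ 2 := rfl
      nlinarith [sq_nonneg (p s)]
    by_contra hne
    have h4 := (sin_pos_of_mem_Ioc hs').ne'
    have : 0 < A * (sin s ^ n * w s) ^ 2 := by positivity
    linarith
  have hlim : Filter.Tendsto w (nhdsWithin 0 (Ioo 0 t)) (nhds (w 0)) :=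
    (h.cont_w 0 ⟨le_rfl, by positivity⟩).mono fun s hs => ⟨hs.1.le, hs.2.le.trans ht.2⟩
  have hlim' : Filter.Tendsto w (nhdsWithin 0 (Ioo 0 t)) (nhds 0) :=
    tendsto_const_nhds.congr' (Filter.eventuallyEq_of_mem self_mem_nhdsWithin
      fun s hs => (hzero s hs).symm)
  have : (nhdsWithin (0 : ℝ) (Ioo 0 t)).NeBot := left_nhdsWithin_Ioo_neBot ht0
  exact h.w_zero (tendsto_nhds_unique hlim hlim')

theorem eventually_p_ne_zero_nhdsGT (h : IsLinSystem n A w p) (hA : 0 < A) :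
    ∀ᶠ t in nhdsWithin 0 (Ioi 0), p t ≠ 0 := by
  wlog hw : 0 < w 0 generalizing w p
  · have := this h.neg (by simpa using lt_of_le_of_ne (not_lt.1 hw) h.w_zero)
    simpa using this
  have h1 : ∀ᶠ t in nhdsWithin 0 (Icc 0 (π / 2)), 0 < w t :=
    (h.cont_w 0 ⟨le_rfl, by positivity⟩).eventually_const_lt hw
  rw [nhdsWithin_Icc_eq_nhdsGE (by positivity)] at h1
  obtain ⟨d, hd, hd'⟩ := (mem_nhdsGE_iff_exists_Ico_subset' (show (0 : ℝ) < π / 2 by positivity)).1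
    (Filter.inter_mem h1 (Ico_mem_nhdsGE (show (0 : ℝ) < π / 2 by positivity)))
  have hanti : StrictAntiOn p (Ico 0 d) := by
    refine strictAntiOn_of_deriv_neg (convex_Ico _ _)
      (h.cont_p.mono fun t ht => ⟨ht.1, (hd' ht).2.2.le⟩) ?_
    intro t ht
    rw [interior_Ico] at ht
    have ht' := hd' ⟨ht.1.le, ht.2⟩
    have hmem : t ∈ Ioc 0 (π / 2) := ⟨ht.1, ht'.2.2.le⟩
    rw [(h.deriv_p t hmem).deriv]
    have h1 := sin_pos_of_mem_Ioc hmem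
    have h2 : 0 < w t := ht'.1
    have : 0 < A * sin t ^ n * w t := by positivity
    linarith
  filter_upwards [Ioo_mem_nhdsGT hd] with t ht
  have := hanti ⟨le_rfl, hd⟩ ⟨ht.1.le, ht.2⟩ ht.1
  rw [h.p_zero] at this
  exact this.ne

theorem finite_zeros (h : IsLinSystem n A w p) (hA : 0 < A) :
    {t ∈ Ioo 0 (π / 2) | p t = 0}.Finite := by
  by_contra hinf
  have hsub : {t ∈ Ioo 0 (π / 2) | p t = 0} ⊆ Icc 0 (π / 2) := fun t ht => Ioo_subset_Icc_self ht.1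
  obtain ⟨x, hx, hacc⟩ := Set.Infinite.exists_accPt_of_subset_isCompact hinf isCompact_Icc hsub
  rw [accPt_iff_frequently] at hacc
  rcases hx.1.eq_or_lt with rfl | hx0
  · have h1 := eventually_nhdsWithin_iff.1 (h.eventually_p_ne_zero_nhdsGT hA)
    obtain ⟨y, ⟨-, hy⟩, hy'⟩ := (hacc.and_eventually h1).exists
    exact hy' hy.1.1 hy.2
  · have hmem : x ∈ Ioc 0 (π / 2) := ⟨hx0, hx.2⟩
    have hd := h.deriv_p x hmem
    have hpx : p x = 0 := by
      by_contra hne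
      obtain ⟨y, ⟨-, hy⟩, hy'⟩ := (hacc.and_eventually (hd.continuousAt.eventually_ne hne)).exists
      exact hy' hy.2
    have hw := h.w_ne_zero hA hx hpx
    have hs := (sin_pos_of_mem_Ioc hmem).ne'
    have h1 := eventually_nhdsWithin_iff.1 (hd.eventually_ne (c := 0)
      (mul_ne_zero (mul_ne_zero (neg_ne_zero.2 hA.ne') (pow_ne_zero n hs)) hw))
    obtain ⟨y, ⟨hne, hy⟩, hy'⟩ := (hacc.and_eventually h1).exists
    exact hy' hne hy.2

theorem not_pos_of_pos {wA pA wB pB : ℝ → ℝ} (hSA : IsLinSystem n A wA pA)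
    (hSB : IsLinSystem n B wB pB) (hA : 0 < A) (hAB : A ≤ B) {a b : ℝ} (ha : 0 ≤ a) (hab : a < b)
    (hb : b ≤ π / 2) (hpa : pA a = 0) (hpb : pA b = 0) (hpos : ∀ t ∈ Ioo a b, 0 < pA t) :
    ¬ ∀ t ∈ Ioc a b, 0 < pB t := by
  intro hposB
  have hsub : Icc a b ⊆ Icc 0 (π / 2) := Icc_subset_Icc ha hb
  have hsub' : Ioo a b ⊆ Ioc 0 (π / 2) := fun t ht => ⟨ha.trans_lt ht.1, ht.2.le.trans hb⟩
  have hbmem : b ∈ Ioc 0 (π / 2) := ⟨ha.trans_lt hab, hb⟩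
  let Q : ℝ → ℝ := fun t => B * (wB t * pA t) - A * (wA t * pB t)
  have hQ : ∀ t ∈ Ioc 0 (π / 2), HasDerivAt Q ((B - A) * (pA t * pB t) / sin t ^ n) t := by
    intro t ht
    have h1 := ((hSB.deriv_w t ht).mul (hSA.deriv_p t ht)).const_mul B
    have h2 := ((hSA.deriv_w t ht).mul (hSB.deriv_p t ht)).const_mul A
    refine (h1.sub h2).congr_deriv ?_
    have := (sin_pos_of_mem_Ioc ht).ne'
    field_simp
    ring
  have hmono : MonotoneOn Q (Icc a b) := by
    refine monotoneOn_of_deriv_nonneg (convex_Icc _ _) ?_ ?_ ?_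
    · refine ContinuousOn.mono ?_ hsub
      exact (continuousOn_const.mul (hSB.cont_w.mul hSA.cont_p)).sub
        (continuousOn_const.mul (hSA.cont_w.mul hSB.cont_p))
    · intro t ht
      rw [interior_Icc] at ht
      exact (hQ t (hsub' ht)).differentiableAt.differentiableWithinAt
    · intro t ht
      rw [interior_Icc] at ht
      rw [(hQ t (hsub' ht)).deriv]
      have h1 := sin_pos_of_mem_Ioc (hsub' ht)
      have h2 := hpos t ht
      have h3 := hposB t (Ioo_subset_Ioc_self ht)
      have h4 : 0 ≤ B - A := by linarith
      positivity
  have hQab : Q a ≤ Q b := hmono ⟨le_rfl, hab.le⟩ ⟨hab.le, le_rfl⟩ hab.le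
  have hwb : 0 < wA b := by
    refine lt_of_le_of_ne ?_ (hSA.w_ne_zero hA (Ioc_subset_Icc_self hbmem) hpb).symm
    have hd : -A * sin b ^ n * wA b ≤ 0 := by
      have h1 : HasDerivWithinAt pA (-A * sin b ^ n * wA b) (Iio b) b :=
        (hSA.deriv_p b hbmem).hasDerivWithinAt
      rw [hasDerivWithinAt_iff_tendsto_slope' (by simp)] at h1
      refine le_of_tendsto h1 ?_
      filter_upwards [Ioo_mem_nhdsLT hab] with t ht
      rw [slope_def_field, hpb]
      exact div_nonpos_of_nonneg_of_nonpos (by linarith [hpos t ht]) (by linarith [ht.2])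
    have h2 := sin_pos_of_mem_Ioc hbmem
    have h3 : 0 < A * sin b ^ n := by positivity
    by_contra! hneg
    nlinarith
  have hQb : Q b < 0 := by
    have h1 := hposB b ⟨hab, le_rfl⟩
    have : 0 < A * (wA b * pB b) := by positivity
    simp only [Q, hpb]
    linarith
  have hQa : 0 ≤ Q a := by
    rcases ha.eq_or_lt with rfl | ha0
    · simp [Q, hSA.p_zero, hSB.p_zero]
    have hamem : a ∈ Ioc 0 (π / 2) := ⟨ha0, hab.le.trans hb⟩
    have hwa : wA a ≤ 0 := by
      have hd : 0 ≤ -A * sin a ^ n * wA a := by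
        have h1 : HasDerivWithinAt pA (-A * sin a ^ n * wA a) (Ioi a) a :=
          (hSA.deriv_p a hamem).hasDerivWithinAt
        rw [hasDerivWithinAt_iff_tendsto_slope' (by simp)] at h1
        refine ge_of_tendsto h1 ?_
        filter_upwards [Ioo_mem_nhdsGT hab] with t ht
        rw [slope_def_field, hpa]
        exact div_nonneg (by linarith [hpos t ht]) (by linarith [ht.1])
      have h2 := sin_pos_of_mem_Ioc hamem
      have h3 : 0 < A * sin a ^ n := by positivity
      by_contra! hneg
      nlinarith
    have hpBa : 0 ≤ pB a := by
      refine ge_of_tendsto ((hSB.deriv_p a hamem).continuousAt.continuousWithinAt (s := Ioi a)) ?_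
      filter_upwards [Ioo_mem_nhdsGT hab] with t ht
      exact (hposB t (Ioo_subset_Ioc_self ht)).le
    have : A * (wA a * pB a) ≤ 0 :=
      mul_nonpos_of_nonneg_of_nonpos hA.le (mul_nonpos_of_nonpos_of_nonneg hwa hpBa)
    simp only [Q, hpa]
    linarith
  linarith

/-- Sturm comparison for the zeros of `p`. -/
theorem exists_zero_mem_Ioc {wA pA wB pB : ℝ → ℝ} (hSA : IsLinSystem n A wA pA)
    (hSB : IsLinSystem n B wB pB) (hA : 0 < A) (hAB : A ≤ B) {a b : ℝ} (ha : 0 ≤ a) (hab : a < b)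
    (hb : b ≤ π / 2) (hpa : pA a = 0) (hpb : pA b = 0) (hne : ∀ t ∈ Ioo a b, pA t ≠ 0) :
    ∃ t ∈ Ioc a b, pB t = 0 := by
  by_contra! hneB
  have hsub : Icc a b ⊆ Icc 0 (π / 2) := Icc_subset_Icc ha hb
  rcases pos_or_neg_of_continuousOn isPreconnected_Ioo
      (hSA.cont_p.mono (Ioo_subset_Icc_self.trans hsub)) hne with h1 | h1 <;>
    rcases pos_or_neg_of_continuousOn isPreconnected_Ioc
      (hSB.cont_p.mono (Ioc_subset_Icc_self.trans hsub)) hneB with h2 | h2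
  · exact not_pos_of_pos hSA hSB hA hAB ha hab hb hpa hpb h1 h2
  · exact not_pos_of_pos hSA hSB.neg hA hAB ha hab hb hpa hpb h1 (by simpa using h2)
  · exact not_pos_of_pos hSA.neg hSB hA hAB ha hab hb (by simpa using hpa) (by simpa using hpb)
      (by simpa using h1) h2
  · exact not_pos_of_pos hSA.neg hSB.neg hA hAB ha hab hb (by simpa using hpa)
      (by simpa using hpb) (by simpa using h1) (by simpa using h2)

theorem ncard_zeros_le {wA pA wB pB : ℝ → ℝ} (hSA : IsLinSystem n A wA pA)
    (hSB : IsLinSystem n B wB pB) (hA : 0 < A) (hAB : A ≤ B) :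
    {t ∈ Ioo 0 (π / 2) | pA t = 0}.ncard ≤ {t ∈ Ioo 0 (π / 2) | pB t = 0}.ncard := by
  set ZA := {t ∈ Ioo 0 (π / 2) | pA t = 0} with hZA
  set ZB := {t ∈ Ioo 0 (π / 2) | pB t = 0} with hZB
  have hfin : ZA.Finite := hSA.finite_zeros hA
  have key : ∀ t ∈ ZA, ∃ z ∈ ZB, z ≤ t ∧ ∀ s ∈ ZA, s < t → s < z := by
    intro t ht
    obtain ⟨a, ⟨haZ, hat⟩, hmax⟩ := Set.exists_max_image (insert 0 ZA ∩ Iio t) id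
      ((hfin.insert 0).inter_of_left _) ⟨0, mem_insert _ _, ht.1.1⟩
    have hat : a < t := hat
    have ha : 0 ≤ a := by
      rcases haZ with rfl | haZ
      exacts [le_rfl, haZ.1.1.le]
    have hpa : pA a = 0 := by
      rcases haZ with rfl | haZ
      exacts [hSA.p_zero, haZ.2]
    obtain ⟨z, hz, hz0⟩ := exists_zero_mem_Ioc hSA hSB hA hAB ha hat ht.1.2.le hpa ht.2
      (fun s hs hs0 => hs.1.not_ge (hmax s
        ⟨mem_insert_of_mem _ ⟨⟨ha.trans_lt hs.1, hs.2.trans ht.1.2⟩, hs0⟩, hs.2⟩))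
    exact ⟨z, ⟨⟨ha.trans_lt hz.1, hz.2.trans_lt ht.1.2⟩, hz0⟩, hz.2,
      fun s hs hst => (hmax s ⟨mem_insert_of_mem _ hs, hst⟩).trans_lt hz.1⟩
  choose! f hfB hft hf using key
  have hstrict : StrictMonoOn f ZA := fun s hs t ht hst =>
    (hft s hs).trans_lt (hf t ht s hs hst)
  exact Set.ncard_le_ncard_of_injOn f hfB hstrict.injOn (hSB.finite_zeros (hA.trans_le hAB))

end IsLinSystem

theorem IsNormalizedLinSolution.isLinSystem {n : ℕ} {A : ℝ} {w : ℝ → ℝ} (hn : 1 ≤ n)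
    (h : IsNormalizedLinSolution (n + 1) A w) :
    IsLinSystem n A w (fun t => sin t ^ n * deriv w t) := by
  obtain ⟨hc, hd, hd2, hw0, hw0', heq⟩ := h
  have hpi := pi_pos
  have hcw : ContinuousOn w (Icc 0 (π / 2)) := hc.mono (Icc_subset_Icc_right (by linarith))
  have hderiv : ∀ t ∈ Ioc 0 (π / 2),
      HasDerivAt (fun t => sin t ^ n * deriv w t) (-A * sin t ^ n * w t) t := by
    intro t ht
    have htp : t ∈ Ioo 0 π := ⟨ht.1, by linarith [ht.2]⟩
    have hs := (sin_pos_of_mem_Ioc ht).ne'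
    refine (((hasDerivAt_sin t).pow n).mul (hd2 t htp).hasDerivAt).congr_deriv ?_
    have h1 := heq t htp
    push_cast at h1
    have h2 : deriv (deriv w) t = -(n * (cos t / sin t) * deriv w t) - A * w t := by linarith
    obtain ⟨k, rfl⟩ : ∃ k, n = k + 1 := ⟨n - 1, by omega⟩
    simp only [Pi.pow_apply, h2, Nat.add_sub_cancel]
    field_simp
    ring
  obtain ⟨M, hM⟩ := isCompact_Icc.exists_bound_of_continuousOn hcw
  have hbound : ∀ t ∈ Ioc 0 (π / 2),
      |sin t ^ n * deriv w t| ≤ |A| * M * t + |slope w 0 t| := by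
    intro t ht
    have hct : ContinuousOn w (Icc 0 t) := hcw.mono (Icc_subset_Icc_right ht.2)
    obtain ⟨x, hx, hxe⟩ := exists_deriv_eq_slope w ht.1 hct fun y hy =>
      (hd y ⟨hy.1.le, by linarith [hy.2, ht.2]⟩).differentiableWithinAt
    have hlip := (convex_Icc x t).norm_image_sub_le_of_norm_hasDerivWithin_le (C := |A| * M)
      (f := fun t => sin t ^ n * deriv w t) (f' := fun t => -A * sin t ^ n * w t)
      (fun y hy => (hderiv y ⟨hx.1.trans_le hy.1, hy.2.trans ht.2⟩).hasDerivWithinAt)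
      (fun y hy => by
        have h1 := hM y ⟨hx.1.le.trans hy.1, hy.2.trans ht.2⟩
        have h2 : |sin y| ^ n ≤ 1 := pow_le_one₀ (abs_nonneg _) (abs_sin_le_one y)
        rw [Real.norm_eq_abs] at h1 ⊢
        rw [abs_mul, abs_mul, abs_neg, abs_pow, mul_assoc]
        refine mul_le_mul_of_nonneg_left ?_ (abs_nonneg _)
        exact (mul_le_of_le_one_left (abs_nonneg _) h2).trans h1)
      (left_mem_Icc.2 hx.2.le) (right_mem_Icc.2 hx.2.le)
    have hM0 : 0 ≤ M := (norm_nonneg _).trans (hM t (Ioc_subset_Icc_self ht))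
    have h3 : |sin x ^ n * deriv w x| ≤ |slope w 0 t| := by
      rw [hxe, slope_def_field, abs_mul, abs_pow]
      exact mul_le_of_le_one_left (abs_nonneg _) (pow_le_one₀ (abs_nonneg _) (abs_sin_le_one x))
    rw [Real.norm_eq_abs, Real.norm_eq_abs, abs_of_pos (sub_pos.2 hx.2)] at hlip
    have h4 : |A| * M * (t - x) ≤ |A| * M * t :=
      mul_le_mul_of_nonneg_left (by linarith [hx.1]) (by positivity)
    have h5 := abs_sub_abs_le_abs_sub (sin t ^ n * deriv w t) (sin x ^ n * deriv w x)
    linarith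
  refine ⟨hcw, ?_, ?_, hderiv, by simp [hw0'], by simp [hw0]⟩
  · intro t ht
    rcases ht.1.eq_or_lt with rfl | ht0
    · refine ContinuousWithinAt.mono ?_ Icc_subset_Ici_self
      rw [← continuousWithinAt_Ioi_iff_Ici, ContinuousWithinAt, hw0', mul_zero]
      have hslope : Filter.Tendsto (slope w 0) (nhdsWithin 0 (Ioi 0)) (nhds 0) := by
        have h1 := (hd 0 ⟨le_rfl, hpi.le⟩).hasDerivAt.hasDerivWithinAt (s := Ioi 0)
        rwa [hasDerivWithinAt_iff_tendsto_slope' (by simp), hw0'] at h1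
      have hid : Filter.Tendsto (fun t : ℝ => |A| * M * t) (nhdsWithin 0 (Ioi 0)) (nhds 0) :=
        ((continuous_const.mul continuous_id).tendsto' 0 0 (by simp)).mono_left nhdsWithin_le_nhds
      refine squeeze_zero_norm' ?_ (by simpa using hid.add hslope.abs)
      filter_upwards [Ioc_mem_nhdsGT (show (0 : ℝ) < π / 2 by positivity)] with t ht
      exact hbound t ht
    · exact (hderiv t ⟨ht0, ht.2⟩).continuousAt.continuousWithinAt
  · intro t ht
    have hs := (sin_pos_of_mem_Ioc ht).ne'
    refine (hd t ⟨ht.1.le, by linarith [ht.2]⟩).hasDerivAt.congr_deriv ?_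
    field_simp

/-- For `0 < A ≤ B`, the number of critical points in `(0, π/2)` of a
normalized solution of the linearized equation is a nondecreasing function of
the parameter. -/
theorem linsol_critical_points_monotone (m : ℕ) (hm : 2 ≤ m) (A B : ℝ)
    (hA : 0 < A) (hAB : A ≤ B) (wA wB : ℝ → ℝ)
    (hwA : IsNormalizedLinSolution m A wA)
    (hwB : IsNormalizedLinSolution m B wB) :
    {t ∈ Ioo (0 : ℝ) (π / 2) | deriv wA t = 0}.Finite ∧
    {t ∈ Ioo (0 : ℝ) (π / 2) | deriv wB t = 0}.Finite ∧
    {t ∈ Ioo (0 : ℝ) (π / 2) | deriv wA t = 0}.ncard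
      ≤ {t ∈ Ioo (0 : ℝ) (π / 2) | deriv wB t = 0}.ncard := by
  obtain ⟨n, rfl⟩ : ∃ n, m = n + 1 := ⟨m - 1, by omega⟩
  have hSA := hwA.isLinSystem (by omega)
  have hSB := hwB.isLinSystem (by omega)
  have hset : ∀ w : ℝ → ℝ, {t ∈ Ioo (0 : ℝ) (π / 2) | deriv w t = 0} =
      {t ∈ Ioo (0 : ℝ) (π / 2) | sin t ^ n * deriv w t = 0} := by
    intro w
    ext t
    refine and_congr_right fun ht => ?_
    have := (sin_pos_of_mem_Ioc (Ioo_subset_Ioc_self ht)).ne'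
    simp [this]
  rw [hset wA, hset wB]
  exact ⟨hSA.finite_zeros hA, hSB.finite_zeros (hA.trans_le hAB),
    hSA.ncard_zeros_le hSB hA hAB⟩
end
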